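/- Suppose [α,γ] interval pattern embeds into [β,θ] (clans α ≤ γ in Clans_{p,q}, β ≤ θ in Clans_{r,s}) via index set I, and let J be the complement of I in {1,…,r+s}. Let w = w_β. Then for every matrix M in the Mars–Springer variety N_{θ,β} and every j ∈ J, all entries in row j of M and in column w(j) of M are 0, except for the entries required to be ±1 by the conditions (O.1)–(O.3) defining S_β. -/

import Mathlib

noncomputable section
open scoped Classical

/-- A `(p,q)`-clan: a partial matching of `{0,…,p+q-1}` (encoded by the involution `mate`)
together with a sign (`true` = `+`, `false` = `-`) at each unmatched position, such that
`#(+) - #(-) = p - q`.  Matched positions carry the junk sign `true`. -/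
structure Clan (p q : ℕ) where
  mate : Fin (p + q) → Fin (p + q)
  mate_invol : ∀ i, mate (mate i) = i
  sign : Fin (p + q) → Bool
  sign_matched : ∀ i, mate i ≠ i → sign i = true
  plus_minus :
    (Finset.univ.filter fun i => mate i = i ∧ sign i = true).card + q
      = (Finset.univ.filter fun i => mate i = i ∧ sign i = false).card + p

namespace Clan

variable {p q r s : ℕ}

/-- position `i` carries a `+`. -/
def IsPlus (c : Clan p q) (i : Fin (p + q)) : Prop :=
  c.mate i = i ∧ c.sign i = true

/-- position `i` carries a `-`. -/
def IsMinus (c : Clan p q) (i : Fin (p + q)) : Prop :=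
  c.mate i = i ∧ c.sign i = false

/-- position `i` is the left end of a matching. -/
def IsLeft (c : Clan p q) (i : Fin (p + q)) : Prop :=
  i < c.mate i

/-- position `i` is the right end of a matching. -/
def IsRight (c : Clan p q) (i : Fin (p + q)) : Prop :=
  c.mate i < i

/-- `(i < j)` is a matching of the clan `c`. -/
def IsMatch (c : Clan p q) (i j : Fin (p + q)) : Prop :=
  i < j ∧ c.mate i = j

/-- The length `ℓ(c)` of a clan:
`ℓ(c) = Σ_{(i<j) matching} (j - i - #{matchings (s<t) with s < i < t < j})`. -/
def len (c : Clan p q) : ℤ :=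
  ∑ ij ∈ Finset.univ.filter (fun ij : Fin (p + q) × Fin (p + q) => c.IsMatch ij.1 ij.2),
    (((ij.2 : ℕ) : ℤ) - ((ij.1 : ℕ) : ℤ) -
      ((Finset.univ.filter (fun st : Fin (p + q) × Fin (p + q) =>
          c.IsMatch st.1 st.2 ∧ st.1 < ij.1 ∧ ij.1 < st.2 ∧ st.2 < ij.2)).card : ℤ))

/-- `c` and `c'` agree (same symbols, same matchings) at every position outside `S`. -/
def AgreeOutside (c c' : Clan p q) (S : Set (Fin (p + q))) : Prop :=
  ∀ i, i ∉ S → c.mate i = c'.mate i ∧ c.sign i = c'.sign i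

/-- `c'` is obtained from `c` by one of the transpositions (T.1)–(T.10). -/
def Transposition (c c' : Clan p q) : Prop :=
  -- (T.1)  +- ↦ 11
  (∃ a b, a < b ∧ c.IsPlus a ∧ c.IsMinus b ∧ c'.IsMatch a b ∧
      AgreeOutside c c' {a, b}) ∨
  -- (T.2)  -+ ↦ 11
  (∃ a b, a < b ∧ c.IsMinus a ∧ c.IsPlus b ∧ c'.IsMatch a b ∧
      AgreeOutside c c' {a, b}) ∨
  -- (T.3)  11+ ↦ 1+1
  (∃ a b d, c.IsMatch a b ∧ b < d ∧ c.IsPlus d ∧ c'.IsMatch a d ∧ c'.IsPlus b ∧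
      AgreeOutside c c' {a, b, d}) ∨
  -- (T.4)  11- ↦ 1-1
  (∃ a b d, c.IsMatch a b ∧ b < d ∧ c.IsMinus d ∧ c'.IsMatch a d ∧ c'.IsMinus b ∧
      AgreeOutside c c' {a, b, d}) ∨
  -- (T.5)  +11 ↦ 1+1
  (∃ a b d, c.IsPlus a ∧ a < b ∧ c.IsMatch b d ∧ c'.IsMatch a d ∧ c'.IsPlus b ∧
      AgreeOutside c c' {a, b, d}) ∨
  -- (T.6)  -11 ↦ 1-1
  (∃ a b d, c.IsMinus a ∧ a < b ∧ c.IsMatch b d ∧ c'.IsMatch a d ∧ c'.IsMinus b ∧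
      AgreeOutside c c' {a, b, d}) ∨
  -- (T.7)  1122 ↦ 1212
  (∃ i j k l, c.IsMatch i j ∧ j < k ∧ c.IsMatch k l ∧ c'.IsMatch i k ∧ c'.IsMatch j l ∧
      AgreeOutside c c' {i, j, k, l}) ∨
  -- (T.8)  1122 ↦ 1+-1
  (∃ i j k l, c.IsMatch i j ∧ j < k ∧ c.IsMatch k l ∧ c'.IsMatch i l ∧ c'.IsPlus j ∧
      c'.IsMinus k ∧ AgreeOutside c c' {i, j, k, l}) ∨
  -- (T.9)  1122 ↦ 1-+1
  (∃ i j k l, c.IsMatch i j ∧ j < k ∧ c.IsMatch k l ∧ c'.IsMatch i l ∧ c'.IsMinus j ∧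
      c'.IsPlus k ∧ AgreeOutside c c' {i, j, k, l}) ∨
  -- (T.10) 1212 ↦ 1221
  (∃ i j k l, i < j ∧ j < k ∧ k < l ∧ c.IsMatch i k ∧ c.IsMatch j l ∧ c'.IsMatch i l ∧
      c'.IsMatch j k ∧ AgreeOutside c c' {i, j, k, l})

/-- Bruhat order `≤` on clans: generated by transpositions. -/
def ble (c c' : Clan p q) : Prop :=
  Relation.ReflTransGen Transposition c c'

/-- Strict Bruhat order `<` on clans. -/
def blt (c c' : Clan p q) : Prop :=
  Relation.TransGen Transposition c c'

/-- Covering relation: `c ⋖ c'` iff `c < c'` and `ℓ(c') = ℓ(c) + 1`. -/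
def Covers (c c' : Clan p q) : Prop :=
  blt c c' ∧ c'.len = c.len + 1

/-- `θ` pattern contains `γ` via the strictly increasing index map `ι`. -/
def Pattern (θ : Clan r s) (γ : Clan p q) (ι : Fin (p + q) → Fin (r + s)) : Prop :=
  StrictMono ι ∧
  (∀ j, γ.mate j = j → θ.mate (ι j) = ι j ∧ θ.sign (ι j) = γ.sign j) ∧
  (∀ k l, γ.IsMatch k l → θ.IsMatch (ι k) (ι l))

/-- `φ` agrees with `θ` at every position outside the range of `ι`. -/
def AgreesWithOutside (φ θ : Clan r s) (ι : Fin (p + q) → Fin (r + s)) : Prop :=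
  ∀ m, (∀ k, ι k ≠ m) → φ.mate m = θ.mate m ∧ φ.sign m = θ.sign m

/-- `[α,γ]` interval pattern embeds into `[β,θ]` via `ι`. -/
def IntervalEmbed (α γ : Clan p q) (β θ : Clan r s)
    (ι : Fin (p + q) → Fin (r + s)) : Prop :=
  Pattern θ γ ι ∧ Pattern β α ι ∧ AgreesWithOutside β θ ι ∧
  θ.len - β.len = γ.len - α.len

/-- `θ` interval pattern contains `[α,γ]`. -/
def IntervalContains (θ : Clan r s) (α γ : Clan p q) : Prop :=
  ∃ (ι : Fin (p + q) → Fin (r + s)) (φ : Clan r s), IntervalEmbed α γ φ θ ι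

/-- `γ(i;+)` (here `i` is the number of initial positions considered, i.e. `i` is 1-indexed):
number of `+`'s plus number of matchings entirely among the first `i` positions. -/
def statPlus (c : Clan p q) (i : ℕ) : ℕ :=
  (Finset.univ.filter fun j : Fin (p + q) => (j : ℕ) < i ∧ c.IsPlus j).card +
  (Finset.univ.filter fun ab : Fin (p + q) × Fin (p + q) =>
      c.IsMatch ab.1 ab.2 ∧ (ab.2 : ℕ) < i).card

/-- `γ(i;-)`, as in `statPlus` with `-`'s. -/
def statMinus (c : Clan p q) (i : ℕ) : ℕ :=
  (Finset.univ.filter fun j : Fin (p + q) => (j : ℕ) < i ∧ c.IsMinus j).card +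
  (Finset.univ.filter fun ab : Fin (p + q) × Fin (p + q) =>
      c.IsMatch ab.1 ab.2 ∧ (ab.2 : ℕ) < i).card

/-- `γ(i;j)` (with `i < j` 1-indexed): number of matchings with left endpoint weakly left
of `i` and right endpoint strictly right of `j`. -/
def statMid (c : Clan p q) (i j : ℕ) : ℕ :=
  (Finset.univ.filter fun ab : Fin (p + q) × Fin (p + q) =>
      c.IsMatch ab.1 ab.2 ∧ (ab.1 : ℕ) < i ∧ j ≤ (ab.2 : ℕ)).card

/-- The permutation `w_c` associated to a clan `c`, 0-indexed: positions carrying a `+` or a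
left endpoint get (in left-to-right order) the values `0,…,p-1`; the remaining values
`p,…,p+q-1` are assigned, scanning left to right, to each `-` as it is encountered and to the
right end of each matching as soon as its left end is encountered. -/
def wNat (c : Clan p q) (i : Fin (p + q)) : ℕ :=
  if c.IsPlus i ∨ c.IsLeft i then
    (Finset.univ.filter fun j : Fin (p + q) => (c.IsPlus j ∨ c.IsLeft j) ∧ j < i).card
  else
    p + (Finset.univ.filter fun j : Fin (p + q) =>
        (c.IsMinus j ∨ c.IsLeft j) ∧ j < (if c.IsMinus i then i else c.mate i)).card

/-- Membership in the affine space `S_c`: the conditions (O.1)–(O.3) and (Z.1)–(Z.9). -/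
def MemS (c : Clan p q) (M : Matrix (Fin (p + q)) (Fin (p + q)) ℂ) : Prop :=
  -- (O.1)
  (∀ i j : Fin (p + q), c.mate i = i → (j : ℕ) = c.wNat i → M i j = 1) ∧
  -- (O.2)
  (∀ i i' j : Fin (p + q), c.IsMatch i i' →
      ((j : ℕ) = c.wNat i ∨ (j : ℕ) = c.wNat i') → M i j = 1) ∧
  -- (O.3)
  (∀ i i' j : Fin (p + q), c.IsMatch i i' → (j : ℕ) = c.wNat i → M i' j = -1) ∧
  (∀ i i' j : Fin (p + q), c.IsMatch i i' → (j : ℕ) = c.wNat i' → M i' j = 1) ∧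
  -- (Z.1): first p columns, rows containing a pivot (rows of +'s and of left endpoints)
  (∀ i j : Fin (p + q), (c.IsPlus i ∨ c.IsLeft i) → (j : ℕ) < p →
      (j : ℕ) ≠ c.wNat i → M i j = 0) ∧
  -- (Z.2): above a pivot, first p columns
  (∀ i x j : Fin (p + q), (c.IsPlus i ∨ c.IsLeft i) → (j : ℕ) = c.wNat i →
      x < i → M x j = 0) ∧
  -- (Z.3): between the pivot 1 and the -1 of a column
  (∀ i i' x j : Fin (p + q), c.IsMatch i i' → (j : ℕ) = c.wNat i →
      i < x → x < i' → M x j = 0) ∧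
  -- (Z.4): right of a -1, within the first p columns
  (∀ i i' j : Fin (p + q), c.IsMatch i i' → c.wNat i < (j : ℕ) → (j : ℕ) < p →
      M i' j = 0) ∧
  -- (Z.5): last q columns, rows containing a pivot (rows of -'s and of left endpoints)
  (∀ i j : Fin (p + q), c.IsMinus i → p ≤ (j : ℕ) → (j : ℕ) ≠ c.wNat i → M i j = 0) ∧
  (∀ i i' j : Fin (p + q), c.IsMatch i i' → p ≤ (j : ℕ) → (j : ℕ) ≠ c.wNat i' →
      M i j = 0) ∧
  -- (Z.6): above a pivot, last q columns
  (∀ i x j : Fin (p + q), c.IsMinus i → (j : ℕ) = c.wNat i → x < i → M x j = 0) ∧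
  (∀ i i' x j : Fin (p + q), c.IsMatch i i' → (j : ℕ) = c.wNat i' → x < i → M x j = 0) ∧
  -- (Z.7): between the pivot 1 and the second 1 of a column
  (∀ i i' x j : Fin (p + q), c.IsMatch i i' → (j : ℕ) = c.wNat i' →
      i < x → x < i' → M x j = 0) ∧
  -- (Z.8): right of a second-1-of-its-column
  (∀ i i' j : Fin (p + q), c.IsMatch i i' → c.wNat i' < (j : ℕ) → M i' j = 0) ∧
  -- (Z.9): identification for 1212 patterns
  (∀ i j k l ci ck : Fin (p + q), c.IsMatch i k → c.IsMatch j l →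
      i < j → j < k → k < l → (ci : ℕ) = c.wNat i → (ck : ℕ) = c.wNat k →
      M l ck = - M l ci)

/-- Rank of the southwest `(n-i) × p` submatrix of `M` (`i` 1-indexed from `1` to `n`). -/
def swRank (p q : ℕ) (M : Matrix (Fin (p + q)) (Fin (p + q)) ℂ) (i : ℕ) : ℕ :=
  Matrix.rank (Matrix.of fun (x : Fin (p + q - i)) (y : Fin p) =>
    M ⟨i + (x : ℕ), by have := x.isLt; omega⟩ ⟨(y : ℕ), by have := y.isLt; omega⟩)

/-- Rank of the southeast `(n-i) × q` submatrix of `M`. -/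
def seRank (p q : ℕ) (M : Matrix (Fin (p + q)) (Fin (p + q)) ℂ) (i : ℕ) : ℕ :=
  Matrix.rank (Matrix.of fun (x : Fin (p + q - i)) (y : Fin q) =>
    M ⟨i + (x : ℕ), by have := x.isLt; omega⟩ ⟨p + (y : ℕ), by have := y.isLt; omega⟩)

/-- Rank of the auxiliary matrix `M^{[i;j]}`: its first `i` columns are the first `i` columns
of `M⁻¹` with the last `q` rows zeroed out, its last `j` columns are the first `j` columns
of `M⁻¹`. -/
def auxRank (p q : ℕ) (M : Matrix (Fin (p + q)) (Fin (p + q)) ℂ) (i j : ℕ) : ℕ :=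
  Matrix.rank (Matrix.of fun (x : Fin (p + q)) (y : Fin i ⊕ Fin j) =>
    Sum.elim
      (fun a : Fin i =>
        if p ≤ (x : ℕ) then (0 : ℂ)
        else if h : (a : ℕ) < p + q then M⁻¹ x ⟨(a : ℕ), h⟩ else 0)
      (fun b : Fin j =>
        if h : (b : ℕ) < p + q then M⁻¹ x ⟨(b : ℕ), h⟩ else 0) y)

/-- The Mars–Springer variety `N_{θ,c}`: matrices of `S_c` satisfying the rank
conditions (R.1)–(R.3) attached to `θ`. -/
def MarsSpringer (θ c : Clan p q) (M : Matrix (Fin (p + q)) (Fin (p + q)) ℂ) : Prop :=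
  MemS c M ∧
  (∀ i : ℕ, 1 ≤ i → i ≤ p + q → swRank p q M i ≤ p - statPlus θ i) ∧
  (∀ i : ℕ, 1 ≤ i → i ≤ p + q → seRank p q M i ≤ q - statMinus θ i) ∧
  (∀ i j : ℕ, 1 ≤ i → i < j → j ≤ p + q → auxRank p q M i j ≤ j + statMid θ i j)

/-- The linear relations defining the coordinates `λ_{k,a}`:
`e_k + Σ_{a ≥ p} λ_{k,a} v_a = Σ_{a < p} λ_{k,a} v_a`, where `v_a` are the columns of `M`. -/
def LambdaRel (p q : ℕ) (M : Matrix (Fin (p + q)) (Fin (p + q)) ℂ)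
    (lam : Fin (p + q) → Fin (p + q) → ℂ) : Prop :=
  ∀ k x : Fin (p + q),
    (if x = k then (1 : ℂ) else 0) +
        ∑ a ∈ Finset.univ.filter (fun a : Fin (p + q) => p ≤ (a : ℕ)), lam k a * M x a
      = ∑ a ∈ Finset.univ.filter (fun a : Fin (p + q) => (a : ℕ) < p), lam k a * M x a

/-- The base point of `S_c`: all free entries set to `0`. -/
def basePoint (c : Clan p q) : Matrix (Fin (p + q)) (Fin (p + q)) ℂ :=
  Matrix.of fun i j =>
    if (j : ℕ) = c.wNat i then 1
    else if c.mate i ≠ i ∧ (j : ℕ) = c.wNat (c.mate i) then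
      (if c.mate i < i then -1 else 1)
    else 0

/-- The diagonal matrix `I_{p,q}` with `p` ones followed by `q` negative ones. -/
def Ipq (p q : ℕ) : Matrix (Fin (p + q)) (Fin (p + q)) ℂ :=
  Matrix.diagonal fun i => if (i : ℕ) < p then 1 else -1

end Clan

namespace Clan

variable {p q : ℕ}

theorem mate_injective (c : Clan p q) : Function.Injective c.mate :=
  (show Function.Involutive c.mate from c.mate_invol).injective

theorem card_filter_isMatch (c : Clan p q) (R : Fin (p + q) → Fin (p + q) → Prop) :
    (Finset.univ.filter fun ab : Fin (p + q) × Fin (p + q) =>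
      c.IsMatch ab.1 ab.2 ∧ R ab.1 ab.2).card
      = (Finset.univ.filter fun a => c.IsLeft a ∧ R a (c.mate a)).card := by
  symm
  refine Finset.card_bij (fun a _ => (a, c.mate a)) ?_ ?_ ?_
  · intro a ha
    rw [Finset.mem_filter] at ha ⊢
    exact ⟨Finset.mem_univ _, ⟨ha.2.1, rfl⟩, ha.2.2⟩
  · intro a _ b _ h
    exact (Prod.mk.inj h).1
  · rintro ⟨a, b⟩ h
    obtain ⟨-, ⟨h1, h2⟩, h3⟩ := Finset.mem_filter.1 h
    obtain rfl : c.mate a = b := h2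
    exact ⟨a, Finset.mem_filter.2 ⟨Finset.mem_univ _, h1, h3⟩, rfl⟩

theorem statMid_eq (c : Clan p q) (i j : ℕ) :
    statMid c i j = (Finset.univ.filter fun a : Fin (p + q) =>
      c.IsLeft a ∧ (a : ℕ) < i ∧ j ≤ (c.mate a : ℕ)).card := by
  unfold statMid
  convert card_filter_isMatch c fun a b => (a : ℕ) < i ∧ j ≤ (b : ℕ)

theorem card_isRight (c : Clan p q) (i : ℕ) :
    (Finset.univ.filter fun a : Fin (p + q) => c.IsRight a ∧ (a : ℕ) < i).card
      = (Finset.univ.filter fun a => c.IsLeft a ∧ (c.mate a : ℕ) < i).card := by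
  refine Finset.card_bij (fun a _ => c.mate a) ?_ ?_ ?_
  · intro a ha
    rw [Finset.mem_filter] at ha ⊢
    simpa [IsRight, IsLeft, c.mate_invol] using ha.2
  · intro a _ b _ h
    exact c.mate_injective h
  · intro a ha
    refine ⟨c.mate a, ?_, c.mate_invol a⟩
    rw [Finset.mem_filter] at ha ⊢
    simpa [IsRight, IsLeft, c.mate_invol] using ha.2

theorem isPlus_or (c : Clan p q) (x : Fin (p + q)) :
    c.IsPlus x ∨ c.IsMinus x ∨ c.IsLeft x ∨ c.IsRight x := by
  unfold IsPlus IsMinus IsLeft IsRight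
  rcases lt_trichotomy (c.mate x) x with h | h | h
  · simp [h]
  · rcases hb : c.sign x <;> simp [h]
  · simp [h]

theorem stat_sum (c : Clan p q) (i : ℕ) (hi : i ≤ p + q) :
    statPlus c i + statMinus c i + statMid c i i = i := by
  have hm : ∀ i : ℕ, (Finset.univ.filter fun ab : Fin (p + q) × Fin (p + q) =>
      c.IsMatch ab.1 ab.2 ∧ (ab.2 : ℕ) < i).card =
      (Finset.univ.filter fun a => c.IsLeft a ∧ (c.mate a : ℕ) < i).card :=
    fun i => by convert card_filter_isMatch c fun _ b => (b : ℕ) < i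
  have hcard : ∀ i : ℕ, i ≤ p + q →
      (Finset.univ.filter fun a : Fin (p + q) => (a : ℕ) < i).card = i := by
    intro i hi
    rw [Fin.card_filter_val_lt]
    omega
  rw [statMid_eq]
  unfold statPlus statMinus
  rw [hm]
  nth_rewrite 1 [← card_isRight]
  conv_rhs => rw [← hcard i hi]
  simp only [Finset.card_filter, ← Finset.sum_add_distrib]
  refine Finset.sum_congr rfl fun x _ => ?_
  simp only [IsPlus, IsMinus, IsLeft, IsRight]
  rcases lt_trichotomy (c.mate x) x with h | h | h
  · have h1 := h.ne
    have h2 := h.not_gt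
    simp [h, h1, h2]
  · by_cases hb : c.sign x = true <;> by_cases hi : (x : ℕ) < i <;> simp [h, hb, hi]
  · have h1 := h.ne'
    have h2 := h.not_gt
    have h3 : (x : ℕ) < c.mate x := h
    simp only [h1, h2, h, false_and, and_false, true_and, if_false]
    split_ifs <;> omega

theorem statMid_full (c : Clan p q) : statMid c (p + q) (p + q) = 0 := by
  rw [statMid_eq, Finset.card_eq_zero, Finset.filter_eq_empty_iff]
  intro a _ h
  have := (c.mate a).isLt
  omega

theorem stat_full (c : Clan p q) : statPlus c (p + q) = p ∧ statMinus c (p + q) = q := by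
  have h := c.stat_sum (p + q) le_rfl
  rw [statMid_full] at h
  have h2 := c.plus_minus
  unfold statPlus statMinus IsPlus IsMinus at *
  simp only [Fin.is_lt, true_and] at *
  omega

theorem statPlus_le (c : Clan p q) {i : ℕ} (hi : i ≤ p + q) : statPlus c i ≤ p := by
  refine le_trans ?_ c.stat_full.1.le
  unfold statPlus
  gcongr

theorem statMinus_le (c : Clan p q) {i : ℕ} (hi : i ≤ p + q) : statMinus c i ≤ q := by
  refine le_trans ?_ c.stat_full.2.le
  unfold statMinus
  gcongr

/-- The number of elements satisfying `R` that precede `x`. -/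
def countBelow {n : ℕ} (R : Fin n → Prop) (x : Fin n) : ℕ :=
  (Finset.univ.filter fun y => R y ∧ y < x).card

theorem countBelow_lt {n : ℕ} {R : Fin n → Prop} {x y : Fin n} (hx : R x) (h : x < y) :
    countBelow R x < countBelow R y := by
  unfold countBelow
  refine Finset.card_lt_card ⟨fun z hz => ?_, fun hs => ?_⟩
  · simp only [Finset.mem_filter, Finset.mem_univ, true_and] at hz ⊢
    exact ⟨hz.1, hz.2.trans h⟩
  · have := hs (Finset.mem_filter.2 ⟨Finset.mem_univ x, hx, h⟩)
    simp at this

theorem countBelow_inj {n : ℕ} {R : Fin n → Prop} {x y : Fin n} (hx : R x) (hy : R y)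
    (h : countBelow R x = countBelow R y) : x = y := by
  rcases lt_trichotomy x y with h1 | h1 | h1
  · exact absurd h (countBelow_lt hx h1).ne
  · exact h1
  · exact absurd h (countBelow_lt hy h1).ne'

theorem countBelow_lt_card {n : ℕ} {R : Fin n → Prop} [DecidablePred R] {x : Fin n} (hx : R x) :
    countBelow R x < (Finset.univ.filter R).card := by
  refine Finset.card_lt_card ⟨fun z hz => ?_, fun hs => ?_⟩
  · simp only [Finset.mem_filter, Finset.mem_univ, true_and] at hz ⊢
    exact hz.1
  · have := hs (Finset.mem_filter.2 ⟨Finset.mem_univ x, hx⟩)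
    simp at this

theorem exists_countBelow_eq {n : ℕ} {R : Fin n → Prop} [DecidablePred R] {m : ℕ}
    (hm : m < (Finset.univ.filter R).card) : ∃ x, R x ∧ countBelow R x = m := by
  have h : (Finset.univ.filter R).image (countBelow R)
      = Finset.range (Finset.univ.filter R).card := by
    refine Finset.eq_of_subset_of_card_le ?_ ?_
    · intro y hy
      obtain ⟨x, hx, rfl⟩ := Finset.mem_image.1 hy
      exact Finset.mem_range.2 (countBelow_lt_card (Finset.mem_filter.1 hx).2)
    · rw [Finset.card_range, Finset.card_image_of_injOn]
      intro x hx y hy hxy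
      exact countBelow_inj (by simpa using hx) (by simpa using hy) hxy
  obtain ⟨x, hx, hxm⟩ := Finset.mem_image.1 (h ▸ Finset.mem_range.2 hm)
  exact ⟨x, (Finset.mem_filter.1 hx).2, hxm⟩

/-- The positions whose rows hold a pivot in the first `p` columns. -/
def PlusLeft (c : Clan p q) (x : Fin (p + q)) : Prop := c.IsPlus x ∨ c.IsLeft x

/-- The positions whose rows hold a pivot in the last `q` columns. -/
def MinusLeft (c : Clan p q) (x : Fin (p + q)) : Prop := c.IsMinus x ∨ c.IsLeft x

theorem card_plusLeft (c : Clan p q) :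
    (Finset.univ.filter fun x => c.PlusLeft x).card = p := by
  have h := c.stat_full.1
  have h2 := card_filter_isMatch c fun _ _ => True
  unfold statPlus at h
  simp only [Fin.is_lt, true_and, and_true] at h h2
  rw [h2] at h
  have hu : (Finset.univ.filter fun x => c.PlusLeft x)
      = Finset.univ.filter (fun x => c.IsPlus x) ∪ Finset.univ.filter fun x => c.IsLeft x := by
    ext x
    simp only [Finset.mem_union, Finset.mem_filter, Finset.mem_univ, true_and]
    rfl
  rw [hu, Finset.card_union_of_disjoint, h]
  refine Finset.disjoint_filter.2 fun x _ h1 h2 => ?_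
  exact h2.ne' h1.1

theorem card_minusLeft (c : Clan p q) :
    (Finset.univ.filter fun x => c.MinusLeft x).card = q := by
  have h := c.stat_full.2
  have h2 := card_filter_isMatch c fun _ _ => True
  unfold statMinus at h
  simp only [Fin.is_lt, true_and, and_true] at h h2
  rw [h2] at h
  have hu : (Finset.univ.filter fun x => c.MinusLeft x)
      = Finset.univ.filter (fun x => c.IsMinus x) ∪ Finset.univ.filter fun x => c.IsLeft x := by
    ext x
    simp only [Finset.mem_union, Finset.mem_filter, Finset.mem_univ, true_and]
    rfl
  rw [hu, Finset.card_union_of_disjoint, h]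
  refine Finset.disjoint_filter.2 fun x _ h1 h2 => ?_
  exact h2.ne' h1.1

theorem countBelow_plusLeft_lt (c : Clan p q) {x : Fin (p + q)} (hx : c.PlusLeft x) :
    countBelow c.PlusLeft x < p :=
  (countBelow_lt_card hx).trans_eq c.card_plusLeft

theorem countBelow_minusLeft_lt (c : Clan p q) {x : Fin (p + q)} (hx : c.MinusLeft x) :
    countBelow c.MinusLeft x < q :=
  (countBelow_lt_card hx).trans_eq c.card_minusLeft

theorem wNat_plusLeft (c : Clan p q) {x : Fin (p + q)} (hx : c.PlusLeft x) :
    c.wNat x = countBelow c.PlusLeft x := by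
  unfold wNat countBelow
  rw [if_pos (show c.IsPlus x ∨ c.IsLeft x from hx)]
  congr!

theorem wNat_isMinus (c : Clan p q) {x : Fin (p + q)} (hx : c.IsMinus x) :
    c.wNat x = p + countBelow c.MinusLeft x := by
  have h : ¬(c.IsPlus x ∨ c.IsLeft x) := by
    rintro (h | h)
    · exact absurd (h.2.symm.trans hx.2) (by simp)
    · exact h.ne' hx.1
  unfold wNat
  rw [if_neg h, if_pos hx]
  unfold countBelow
  congr!

theorem wNat_mate (c : Clan p q) {x : Fin (p + q)} (hx : c.IsLeft x) :
    c.wNat (c.mate x) = p + countBelow c.MinusLeft x := by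
  have hx' : x < c.mate x := hx
  have h : ¬(c.IsPlus (c.mate x) ∨ c.IsLeft (c.mate x)) := by
    rintro (h | h)
    · exact hx'.ne (by simpa [c.mate_invol] using h.1)
    · exact absurd (show c.mate x < c.mate (c.mate x) from h)
        (by rw [c.mate_invol]; exact hx'.not_gt)
  have h' : ¬ c.IsMinus (c.mate x) := fun h => hx'.ne (by simpa [c.mate_invol] using h.1)
  unfold wNat
  rw [if_neg h, if_neg h', c.mate_invol]
  unfold countBelow
  congr!

/-- The column holding the pivot of row `x` among the first `p` columns. -/
def plusCol (c : Clan p q) (x : Fin (p + q)) (hx : c.PlusLeft x) : Fin (p + q) :=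
  ⟨countBelow c.PlusLeft x, (c.countBelow_plusLeft_lt hx).trans_le (Nat.le_add_right _ _)⟩

/-- The column holding the pivot of row `x` among the last `q` columns. -/
def minusCol (c : Clan p q) (x : Fin (p + q)) (hx : c.MinusLeft x) : Fin (p + q) :=
  ⟨p + countBelow c.MinusLeft x, Nat.add_lt_add_left (c.countBelow_minusLeft_lt hx) p⟩

theorem plusCol_lt (c : Clan p q) {x : Fin (p + q)} (hx : c.PlusLeft x) :
    (c.plusCol x hx : ℕ) < p :=
  c.countBelow_plusLeft_lt hx

theorem le_minusCol (c : Clan p q) {x : Fin (p + q)} (hx : c.MinusLeft x) :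
    p ≤ (c.minusCol x hx : ℕ) :=
  Nat.le_add_right _ _

theorem exists_plusCol (c : Clan p q) {k : Fin (p + q)} (hk : (k : ℕ) < p) :
    ∃ x, ∃ hx : c.PlusLeft x, c.plusCol x hx = k := by
  obtain ⟨x, hx, h⟩ := exists_countBelow_eq (R := c.PlusLeft)
    (hk.trans_eq c.card_plusLeft.symm)
  exact ⟨x, hx, Fin.ext h⟩

theorem exists_minusCol (c : Clan p q) {k : Fin (p + q)} (hk : p ≤ (k : ℕ)) :
    ∃ x, ∃ hx : c.MinusLeft x, c.minusCol x hx = k := by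
  obtain ⟨x, hx, h⟩ := exists_countBelow_eq (R := c.MinusLeft) (m := k - p)
    ((show (k : ℕ) - p < q by have := k.isLt; omega).trans_eq c.card_minusLeft.symm)
  refine ⟨x, hx, Fin.ext ?_⟩
  show p + countBelow c.MinusLeft x = k
  omega

theorem isLeft_mate {c : Clan p q} {y : Fin (p + q)} (hy : c.IsRight y) :
    c.IsLeft (c.mate y) := by
  simpa [IsLeft, IsRight, c.mate_invol] using hy

theorem minusCol_eq_of_left {c : Clan p q} {x j : Fin (p + q)} (hx : c.IsLeft x)
    (hj : (j : ℕ) = c.wNat (c.mate x)) : j = c.minusCol x (Or.inr hx) :=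
  Fin.ext (hj.trans (c.wNat_mate hx))

theorem plusCol_eq {c : Clan p q} {x j : Fin (p + q)} (hx : c.PlusLeft x)
    (hj : (j : ℕ) = c.wNat x) : j = c.plusCol x hx :=
  Fin.ext (hj.trans (c.wNat_plusLeft hx))

theorem minusCol_eq_of_minus {c : Clan p q} {x j : Fin (p + q)} (hx : c.IsMinus x)
    (hj : (j : ℕ) = c.wNat x) : j = c.minusCol x (Or.inl hx) :=
  Fin.ext (hj.trans (c.wNat_isMinus hx))

theorem wNat_plusCol {c : Clan p q} {x : Fin (p + q)} (hx : c.PlusLeft x) :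
    (c.plusCol x hx : ℕ) = c.wNat x :=
  (c.wNat_plusLeft hx).symm

theorem wNat_minusCol_left {c : Clan p q} {x : Fin (p + q)} (hx : c.IsLeft x) :
    (c.minusCol x (Or.inr hx) : ℕ) = c.wNat (c.mate x) :=
  (c.wNat_mate hx).symm

theorem wNat_minusCol_minus {c : Clan p q} {x : Fin (p + q)} (hx : c.IsMinus x) :
    (c.minusCol x (Or.inl hx) : ℕ) = c.wNat x :=
  (c.wNat_isMinus hx).symm

namespace MemS

variable {c : Clan p q} {M : Matrix (Fin (p + q)) (Fin (p + q)) ℂ} {x y k : Fin (p + q)}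

theorem plus_pivot (h : MemS c M) (hx : c.PlusLeft x) : M x (c.plusCol x hx) = 1 := by
  obtain ⟨h1, h2, -⟩ := h
  rcases id hx with hx' | hx'
  · exact h1 _ _ hx'.1 (wNat_plusCol hx)
  · exact h2 x (c.mate x) _ ⟨hx', rfl⟩ (Or.inl (wNat_plusCol hx))

theorem minus_pivot (h : MemS c M) (hx : c.MinusLeft x) : M x (c.minusCol x hx) = 1 := by
  obtain ⟨h1, h2, -⟩ := h
  rcases id hx with hx' | hx'
  · exact h1 _ _ hx'.1 (wNat_minusCol_minus hx')
  · exact h2 x (c.mate x) _ ⟨hx', rfl⟩ (Or.inr (wNat_minusCol_left hx'))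

theorem plus_mate (h : MemS c M) (hx : c.IsLeft x) :
    M (c.mate x) (c.plusCol x (Or.inr hx)) = -1 := by
  obtain ⟨-, -, h3, -⟩ := h
  exact h3 x _ _ ⟨hx, rfl⟩ (wNat_plusCol _)

theorem minus_mate (h : MemS c M) (hx : c.IsLeft x) :
    M (c.mate x) (c.minusCol x (Or.inr hx)) = 1 := by
  obtain ⟨-, -, -, h4, -⟩ := h
  exact h4 x _ _ ⟨hx, rfl⟩ (wNat_minusCol_left hx)

theorem plus_row (h : MemS c M) (hx : c.PlusLeft x) (hk : (k : ℕ) < p)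
    (hne : k ≠ c.plusCol x hx) : M x k = 0 := by
  obtain ⟨-, -, -, -, h5, -⟩ := h
  exact h5 x k hx hk fun e => hne (plusCol_eq hx e)

theorem minus_row (h : MemS c M) (hx : c.MinusLeft x) (hk : p ≤ (k : ℕ))
    (hne : k ≠ c.minusCol x hx) : M x k = 0 := by
  obtain ⟨-, -, -, -, -, -, -, -, h9, h10, -⟩ := h
  rcases id hx with hx' | hx'
  · exact h9 x k hx' hk fun e => hne (minusCol_eq_of_minus hx' e)
  · exact h10 x (c.mate x) k ⟨hx', rfl⟩ hk fun e => hne (minusCol_eq_of_left hx' e)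

theorem plus_above (h : MemS c M) (hx : c.PlusLeft x) (hy : y < x) :
    M y (c.plusCol x hx) = 0 := by
  obtain ⟨-, -, -, -, -, h6, -⟩ := h
  exact h6 x y _ hx (wNat_plusCol hx) hy

theorem minus_above (h : MemS c M) (hx : c.MinusLeft x) (hy : y < x) :
    M y (c.minusCol x hx) = 0 := by
  obtain ⟨-, -, -, -, -, -, -, -, -, -, h11, h12, -⟩ := h
  rcases id hx with hx' | hx'
  · exact h11 x y _ hx' (wNat_minusCol_minus hx') hy
  · exact h12 x (c.mate x) y _ ⟨hx', rfl⟩ (wNat_minusCol_left hx') hy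

theorem plus_between (h : MemS c M) (hx : c.IsLeft x) (hy : x < y) (hy' : y < c.mate x) :
    M y (c.plusCol x (Or.inr hx)) = 0 := by
  obtain ⟨-, -, -, -, -, -, h7, -⟩ := h
  exact h7 x _ y _ ⟨hx, rfl⟩ (wNat_plusCol _) hy hy'

theorem minus_between (h : MemS c M) (hx : c.IsLeft x) (hy : x < y) (hy' : y < c.mate x) :
    M y (c.minusCol x (Or.inr hx)) = 0 := by
  obtain ⟨-, -, -, -, -, -, -, -, -, -, -, -, h13, -⟩ := h
  exact h13 x _ y _ ⟨hx, rfl⟩ (wNat_minusCol_left hx) hy hy'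

theorem plus_right (h : MemS c M) (hx : c.PlusLeft x) (hy : c.IsRight y)
    (hyx : c.mate y < x) : M y (c.plusCol x hx) = 0 := by
  obtain ⟨-, -, -, -, -, -, -, h8, -⟩ := h
  refine h8 (c.mate y) y _ ⟨hy, c.mate_invol y⟩ ?_ (c.plusCol_lt hx)
  rw [c.wNat_plusLeft (Or.inr (isLeft_mate hy))]
  exact countBelow_lt (Or.inr (isLeft_mate hy)) hyx

theorem minus_right (h : MemS c M) (hx : c.MinusLeft x) (hy : c.IsRight y)
    (hyx : c.mate y < x) : M y (c.minusCol x hx) = 0 := by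
  obtain ⟨-, -, -, -, -, -, -, -, -, -, -, -, -, h14, -⟩ := h
  refine h14 (c.mate y) y _ ⟨hy, c.mate_invol y⟩ ?_
  have := c.wNat_mate (isLeft_mate hy)
  rw [c.mate_invol] at this
  rw [this]
  exact Nat.add_lt_add_left (countBelow_lt (Or.inr (isLeft_mate hy)) hyx) p

theorem crossing (h : MemS c M) (hx : c.IsLeft x) (hy : c.IsRight y) (h1 : x < c.mate y)
    (h2 : c.mate y < c.mate x) (h3 : c.mate x < y) :
    M y (c.minusCol x (Or.inr hx)) = - M y (c.plusCol x (Or.inr hx)) := by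
  obtain ⟨-, -, -, -, -, -, -, -, -, -, -, -, -, -, h15⟩ := h
  exact h15 x (c.mate y) (c.mate x) y _ _ ⟨hx, rfl⟩ ⟨hy, c.mate_invol y⟩ h1 h2 h3
    (wNat_plusCol _) (wNat_minusCol_left hx)

open Matrix

theorem mulVec_step {u₀ : Fin (p + q) → ℂ}
    (ih : ∀ y, k < y → ∃ u, M *ᵥ u = Pi.single y 1 ∧
      ∀ x, x < c.mate y → (M *ᵥ (Ipq p q *ᵥ u)) x = 0)
    (h₁ : ∀ x, x < k → (M *ᵥ u₀) x = 0) (h₂ : (M *ᵥ u₀) k = 1)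
    (h₃ : ∀ x, x < c.mate k → (M *ᵥ (Ipq p q *ᵥ u₀)) x = 0)
    (h₄ : ∀ y, k < y → (M *ᵥ u₀) y ≠ 0 → c.mate k ≤ c.mate y) :
    ∃ u, M *ᵥ u = Pi.single k 1 ∧
      ∀ x, x < c.mate k → (M *ᵥ (Ipq p q *ᵥ u)) x = 0 := by
  choose! f hf hf' using ih
  refine ⟨u₀ - ∑ y ∈ Finset.univ.filter (fun y => k < y), (M *ᵥ u₀) y • f y, ?_, ?_⟩
  · rw [mulVec_sub, mulVec_sum]
    ext x
    simp only [mulVec_smul, Pi.sub_apply, Finset.sum_apply, Pi.smul_apply, smul_eq_mul]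
    rw [Finset.sum_congr rfl (g := fun y => if x = y then (M *ᵥ u₀) y else 0) (fun y hy => by
      rw [hf y (Finset.mem_filter.1 hy).2]
      simp [Pi.single_apply]), Finset.sum_ite_eq]
    rcases lt_trichotomy x k with h | h | h
    · simp [h₁ x h, h.not_gt, h.ne]
    · simp [h, h₂]
    · simp [h, h.ne']
  · intro x hx
    rw [mulVec_sub, mulVec_sub, mulVec_sum, mulVec_sum]
    simp only [mulVec_smul, Pi.sub_apply, Finset.sum_apply, Pi.smul_apply, smul_eq_mul]
    rw [h₃ x hx, Finset.sum_eq_zero, sub_zero]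
    intro y hy
    have hy := (Finset.mem_filter.1 hy).2
    by_cases h0 : (M *ᵥ u₀) y = 0
    · rw [h0, zero_mul]
    · rw [hf' y hy x (hx.trans_le (h₄ y hy h0)), mul_zero]

theorem Ipq_mulVec_plus (hk : (k : ℕ) < p) (a : ℂ) :
    Ipq p q *ᵥ Pi.single k a = Pi.single k a := by
  ext x
  simp only [Ipq, mulVec_diagonal, Pi.single_apply]
  split_ifs <;> simp_all

theorem Ipq_mulVec_minus (hk : p ≤ (k : ℕ)) (a : ℂ) :
    Ipq p q *ᵥ Pi.single k a = - Pi.single k a := by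
  ext x
  simp only [Ipq, mulVec_diagonal, Pi.neg_apply, Pi.single_apply]
  split_ifs with h1 h2
  · subst h2; omega
  all_goals simp

theorem exists_preimage (h : MemS c M) (k : Fin (p + q)) :
    ∃ u, M *ᵥ u = Pi.single k 1 ∧
      ∀ x, x < c.mate k → (M *ᵥ (Ipq p q *ᵥ u)) x = 0 := by
  induction k using (wellFounded_gt (α := Fin (p + q))).induction with
  | _ k ih =>
  have single : ∀ (a : Fin (p + q)) (z : ℂ) y, (M *ᵥ Pi.single a z) y = M y a * z := by
    intro a z y
    simp
  rcases c.isPlus_or k with hk | hk | hk | hk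
  · have hk' : c.PlusLeft k := Or.inl hk
    refine mulVec_step (u₀ := Pi.single (c.plusCol k hk') 1) ih ?_ ?_ ?_ ?_
    · intro x hx
      rw [single, h.plus_above hk' hx, zero_mul]
    · rw [single, h.plus_pivot hk', one_mul]
    · intro x hx
      rw [hk.1] at hx
      rw [Ipq_mulVec_plus (c.plusCol_lt hk'), single, h.plus_above hk' hx, zero_mul]
    · intro y hy hne
      rw [single, mul_one] at hne
      rw [hk.1]
      by_contra! hlt
      exact hne (h.plus_right hk' (hlt.trans hy) hlt)
  · have hk' : c.MinusLeft k := Or.inl hk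
    refine mulVec_step (u₀ := Pi.single (c.minusCol k hk') 1) ih ?_ ?_ ?_ ?_
    · intro x hx
      rw [single, h.minus_above hk' hx, zero_mul]
    · rw [single, h.minus_pivot hk', one_mul]
    · intro x hx
      rw [hk.1] at hx
      rw [Ipq_mulVec_minus (c.le_minusCol hk'), mulVec_neg, Pi.neg_apply, single,
        h.minus_above hk' hx, zero_mul, neg_zero]
    · intro y hy hne
      rw [single, mul_one] at hne
      rw [hk.1]
      by_contra! hlt
      exact hne (h.minus_right hk' (hlt.trans hy) hlt)
  · have hp : c.PlusLeft k := Or.inr hk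
    have hm : c.MinusLeft k := Or.inr hk
    refine mulVec_step (u₀ := Pi.single (c.plusCol k hp) (1 / 2) +
      Pi.single (c.minusCol k hm) (1 / 2)) ih ?_ ?_ ?_ ?_
    · intro x hx
      rw [mulVec_add, Pi.add_apply, single, single, h.plus_above hp hx, h.minus_above hm hx]
      ring
    · rw [mulVec_add, Pi.add_apply, single, single, h.plus_pivot hp, h.minus_pivot hm]
      ring
    · intro x hx
      rw [mulVec_add, Ipq_mulVec_plus (c.plusCol_lt hp), Ipq_mulVec_minus (c.le_minusCol hm),
        mulVec_add, mulVec_neg, Pi.add_apply, Pi.neg_apply, single, single]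
      rcases lt_trichotomy x k with hxk | hxk | hxk
      · rw [h.plus_above hp hxk, h.minus_above hm hxk]
        ring
      · rw [hxk, h.plus_pivot hp, h.minus_pivot hm]
        ring
      · rw [h.plus_between hk hxk hx, h.minus_between hk hxk hx]
        ring
    · intro y hy hne
      rw [mulVec_add, Pi.add_apply, single, single, ← add_mul] at hne
      by_contra! hlt
      apply hne
      rcases lt_trichotomy y (c.mate k) with hyk | hyk | hyk
      · rw [h.plus_between hk hy hyk, h.minus_between hk hy hyk]
        ring
      · rw [hyk, h.plus_mate hk, h.minus_mate hk]
        ring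
      · have hr : c.IsRight y := hlt.trans hyk
        rcases lt_trichotomy (c.mate y) k with hyk' | hyk' | hyk'
        · rw [h.plus_right hp hr hyk', h.minus_right hm hr hyk']
          ring
        · rw [← hyk', c.mate_invol] at hyk
          exact absurd hyk (lt_irrefl _)
        · rw [h.crossing hk hr hyk' hlt hyk]
          ring
  · obtain ⟨l, rfl⟩ : ∃ l, c.mate l = k := ⟨c.mate k, c.mate_invol k⟩
    have hl : c.IsLeft l := by simpa [c.mate_invol] using isLeft_mate hk
    rw [c.mate_invol]
    have hp : c.PlusLeft l := Or.inr hl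
    have hm : c.MinusLeft l := Or.inr hl
    have hlt : l < c.mate l := hl
    have := mulVec_step (u₀ := Pi.single (c.minusCol l hm) (1 / 2) -
      Pi.single (c.plusCol l hp) (1 / 2)) ih ?_ ?_ ?_ ?_
    · rwa [c.mate_invol] at this
    · intro x hx
      rw [mulVec_sub, Pi.sub_apply, single, single]
      rcases lt_trichotomy x l with hxk | hxk | hxk
      · rw [h.plus_above hp hxk, h.minus_above hm hxk]
        ring
      · rw [hxk, h.plus_pivot hp, h.minus_pivot hm]
        ring
      · rw [h.plus_between hl hxk hx, h.minus_between hl hxk hx]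
        ring
    · rw [mulVec_sub, Pi.sub_apply, single, single, h.plus_mate hl, h.minus_mate hl]
      ring
    · intro x hx
      rw [c.mate_invol] at hx
      rw [mulVec_sub, Ipq_mulVec_plus (c.plusCol_lt hp), Ipq_mulVec_minus (c.le_minusCol hm),
        mulVec_sub, mulVec_neg, Pi.sub_apply, Pi.neg_apply, single, single,
        h.plus_above hp hx, h.minus_above hm hx]
      ring
    · intro y hy hne
      rw [mulVec_sub, Pi.sub_apply, single, single, ← sub_mul] at hne
      rw [c.mate_invol]
      by_contra! hlt'
      have hr : c.IsRight y := hlt'.trans (hlt.trans hy)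
      apply hne
      rw [h.plus_right hp hr hlt', h.minus_right hm hr hlt']
      ring

theorem isUnit_det (h : MemS c M) : IsUnit M.det := by
  choose u hu _ using h.exists_preimage
  refine isUnit_det_of_right_inverse (B := Matrix.of fun x y => u y x) ?_
  ext x y
  have := congrFun (hu y) x
  rw [one_apply]
  simpa [mulVec, dotProduct, mul_apply, Pi.single_apply] using this

end MemS

open Matrix

/-- The involution of `ℂ^(p+q)` fixing the first `p` columns of `M` and negating the others. -/
def reflection (M : Matrix (Fin (p + q)) (Fin (p + q)) ℂ) : Matrix (Fin (p + q)) (Fin (p + q)) ℂ :=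
  M * Ipq p q * M⁻¹

theorem Ipq_mul_self : Ipq p q * Ipq p q = 1 := by
  rw [Ipq, diagonal_mul_diagonal, ← diagonal_one]
  congr 1
  ext i
  split_ifs <;> simp

theorem reflection_mul_self {M : Matrix (Fin (p + q)) (Fin (p + q)) ℂ} (hM : IsUnit M.det) :
    reflection M * reflection M = 1 := by
  unfold reflection
  calc M * Ipq p q * M⁻¹ * (M * Ipq p q * M⁻¹)
      = M * Ipq p q * (M⁻¹ * M) * Ipq p q * M⁻¹ := by simp only [Matrix.mul_assoc]
    _ = M * (Ipq p q * Ipq p q) * M⁻¹ := by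
      rw [nonsing_inv_mul M hM, Matrix.mul_one]
      simp only [Matrix.mul_assoc]
    _ = 1 := by rw [Ipq_mul_self, Matrix.mul_one, mul_nonsing_inv M hM]

theorem MemS.reflection_col {c : Clan p q} {M : Matrix (Fin (p + q)) (Fin (p + q)) ℂ}
    (h : MemS c M) {x k : Fin (p + q)} (hx : x < c.mate k) : reflection M x k = 0 := by
  obtain ⟨u, hu, hu'⟩ := h.exists_preimage k
  have hu2 : u = M⁻¹ *ᵥ Pi.single k 1 := by
    rw [← hu, mulVec_mulVec, nonsing_inv_mul M h.isUnit_det, one_mulVec]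
  have := hu' x hx
  rw [hu2, mulVec_mulVec, mulVec_mulVec] at this
  simpa [reflection] using this

theorem MemS.reflection_row {c : Clan p q} {M : Matrix (Fin (p + q)) (Fin (p + q)) ℂ}
    (h : MemS c M) {x k : Fin (p + q)} (hk : c.mate x < k) : reflection M x k = 0 := by
  have hT := reflection_mul_self h.isUnit_det
  let σ : Fin (p + q) ≃ Fin (p + q) := ⟨c.mate, c.mate, c.mate_invol, c.mate_invol⟩
  let L := (reflection M).submatrix id σ
  let L' := (reflection M).submatrix σ id
  have hLL' : L * L' = 1 := by
    rw [submatrix_mul_equiv, hT]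
    rfl
  have hL : BlockTriangular L OrderDual.toDual := by
    intro a b hab
    exact h.reflection_col (by simpa [σ, c.mate_invol] using hab)
  have hinv : L⁻¹ = L' := inv_eq_right_inv hLL'
  let _ := invertibleOfRightInverse _ _ hLL'
  have := blockTriangular_inv_of_blockTriangular hL
  rw [hinv] at this
  have h2 := this (i := c.mate x) (j := k) (by simpa using hk)
  simpa [L', σ, c.mate_invol] using h2

/-- Extension by zero along `e`. -/
def extendZero {m n : Type*} (e : m → n) : (m → ℂ) →ₗ[ℂ] (n → ℂ) :=
  Function.ExtendByZero.linearMap ℂ e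

theorem extendZero_apply {m n : Type*} {e : m → n} (he : e.Injective) (u : m → ℂ) (a : m) :
    extendZero e u (e a) = u a :=
  he.extend_apply _ _ _

theorem extendZero_apply' {m n : Type*} {e : m → n} (u : m → ℂ) {b : n} (hb : ∀ a, e a ≠ b) :
    extendZero e u b = 0 :=
  Function.extend_apply' _ _ _ (by simpa using hb)

theorem extendZero_injective {m n : Type*} {e : m → n} (he : e.Injective) :
    Function.Injective (extendZero e) := fun u v h => by
  ext a
  rw [← extendZero_apply he u, h, extendZero_apply he]

theorem submatrix_mulVec_extendZero {l m n k : Type*} [Fintype m] [Fintype n]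
    (T : Matrix l n ℂ) (r : k → l) {e : m → n} (he : e.Injective) (u : m → ℂ) (x : k) :
    (T.submatrix r e *ᵥ u) x = (T *ᵥ extendZero e u) (r x) := by
  refine Fintype.sum_of_injective e he _ _ (fun b hb => ?_) fun a => ?_
  · rw [extendZero_apply' u (by simpa using hb), mul_zero]
  · rw [extendZero_apply he]
    rfl

theorem card_le_rank {l m n k : Type*} [Fintype m] [Fintype n] [Finite k]
    (T : Matrix l n ℂ) (r : k → l) {e : m → n} (he : e.Injective) (D : Finset n)
    (hD : ∀ a ∈ D, ∃ b, e b = a)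
    (hind : ∀ u : n → ℂ, (∀ a ∉ D, u a = 0) → (∀ x, (T *ᵥ u) (r x) = 0) → u = 0) :
    D.card ≤ (T.submatrix r e).rank := by
  choose g hg using hD
  have hg' : Function.Injective fun a : D => g a a.2 := fun a b hab => by
    refine Subtype.ext ?_
    rw [← hg a a.2, ← hg b b.2]
    exact congrArg e hab
  have key : Function.Injective
      ((T.submatrix r e).mulVecLin.rangeRestrict ∘ₗ extendZero fun a : D => g a a.2) := by
    rw [injective_iff_map_eq_zero]
    intro w hw
    have h0 := hind (extendZero e (extendZero (fun a : D => g a a.2) w)) ?_ ?_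
    · exact extendZero_injective hg' (extendZero_injective he (h0.trans (by simp)))
    · intro a ha
      by_cases hb : ∃ b, e b = a
      · obtain ⟨b, rfl⟩ := hb
        rw [extendZero_apply he, extendZero_apply']
        rintro a' rfl
        exact ha (by rw [hg a' a'.2]; exact a'.2)
      · exact extendZero_apply' _ fun b hb' => hb ⟨b, hb'⟩
    · intro x
      rw [← submatrix_mulVec_extendZero T r he]
      exact congrFun (congrArg Subtype.val hw) x
  have := LinearMap.finrank_le_finrank_of_injective key
  simpa [Matrix.rank] using this

theorem finrank_ker_add_rank {m n : Type*} [Fintype n] (A : Matrix m n ℂ) :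
    Module.finrank ℂ (LinearMap.ker A.mulVecLin) + A.rank = Fintype.card n := by
  rw [add_comm, Matrix.rank, LinearMap.finrank_range_add_finrank_ker, Module.finrank_pi]

/-- The block of `T` on the rows `≥ j` and the columns `< i`. -/
def lowerBlock {n : ℕ} (T : Matrix (Fin n) (Fin n) ℂ) {i : ℕ} (hi : i ≤ n) (j : ℕ) :
    Matrix {x : Fin n // j ≤ x} (Fin i) ℂ :=
  T.submatrix Subtype.val (Fin.castLE hi)

theorem lowerBlock_mulVec_eq_zero {n : ℕ} {T : Matrix (Fin n) (Fin n) ℂ} {i j : ℕ}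
    (hi : i ≤ n) (u : Fin i → ℂ) :
    lowerBlock T hi j *ᵥ u = 0 ↔
      ∀ x : Fin n, j ≤ x → (T *ᵥ extendZero (Fin.castLE hi) u) x = 0 := by
  rw [funext_iff]
  simp only [lowerBlock, submatrix_mulVec_extendZero T _ (Fin.castLE_injective hi),
    Subtype.forall, Pi.zero_apply]

theorem reflection_mulVec_mulVec {M : Matrix (Fin (p + q)) (Fin (p + q)) ℂ}
    (hM : IsUnit M.det) (u : Fin (p + q) → ℂ) :
    reflection M *ᵥ (M *ᵥ u) = M *ᵥ (Ipq p q *ᵥ u) := by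
  rw [reflection, mulVec_mulVec, Matrix.mul_assoc, nonsing_inv_mul M hM, Matrix.mul_one,
    mulVec_mulVec]

theorem extendZero_castLE_eq_zero {n i j : ℕ} (hi : i ≤ n) (hij : i ≤ j) (u : Fin i → ℂ)
    {x : Fin n} (hx : j ≤ x) : extendZero (Fin.castLE hi) u x = 0 :=
  extendZero_apply' u fun a ha => by
    have h1 := congrArg Fin.val ha
    have h2 := a.isLt
    simp only [Fin.val_castLE] at h1
    omega

theorem rank_lowerBlock_add_le_auxRank {M : Matrix (Fin (p + q)) (Fin (p + q)) ℂ}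
    (hM : IsUnit M.det) {i j : ℕ} (hij : i ≤ j) (hi : i ≤ p + q) (hj : j ≤ p + q) :
    (lowerBlock (reflection M) hi j).rank + j ≤ auxRank p q M i j := by
  unfold auxRank
  set A := Matrix.of fun (x : Fin (p + q)) (y : Fin i ⊕ Fin j) =>
    Sum.elim
      (fun a : Fin i =>
        if p ≤ (x : ℕ) then (0 : ℂ)
        else if h : (a : ℕ) < p + q then M⁻¹ x ⟨(a : ℕ), h⟩ else 0)
      (fun b : Fin j =>
        if h : (b : ℕ) < p + q then M⁻¹ x ⟨(b : ℕ), h⟩ else 0) y with hA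
  have hAz : ∀ z : Fin i ⊕ Fin j → ℂ, A *ᵥ z = 0 →
      reflection M *ᵥ extendZero (Fin.castLE hi) (z ∘ Sum.inl) =
        - extendZero (Fin.castLE hi) (z ∘ Sum.inl)
        - (2 : ℂ) • extendZero (Fin.castLE hj) (z ∘ Sum.inr) := by
    intro z hz
    set u := extendZero (Fin.castLE hi) (z ∘ Sum.inl) with hu
    set v := extendZero (Fin.castLE hj) (z ∘ Sum.inr) with hv
    have h1 : Ipq p q *ᵥ (M⁻¹ *ᵥ u) + M⁻¹ *ᵥ u + (2 : ℂ) • (M⁻¹ *ᵥ v) = 0 := by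
      ext x
      have hx := congrFun hz x
      have e1 : ∑ a : Fin i, M⁻¹ x (Fin.castLE hi a) * z (Sum.inl a) = (M⁻¹ *ᵥ u) x :=
        submatrix_mulVec_extendZero M⁻¹ id (Fin.castLE_injective hi) _ x
      have e2 : ∑ b : Fin j, M⁻¹ x (Fin.castLE hj b) * z (Sum.inr b) = (M⁻¹ *ᵥ v) x :=
        submatrix_mulVec_extendZero M⁻¹ id (Fin.castLE_injective hj) _ x
      have hx' : (if (x : ℕ) < p then (M⁻¹ *ᵥ u) x else 0) + (M⁻¹ *ᵥ v) x = 0 := by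
        rw [← e1, ← e2]
        rw [mulVec, dotProduct, Fintype.sum_sum_type] at hx
        rw [Pi.zero_apply] at hx
        refine Eq.trans ?_ hx
        congr 1
        · split_ifs with hxp
          · refine Finset.sum_congr rfl fun a _ => ?_
            have ha : (a : ℕ) < p + q := a.isLt.trans_le hi
            simp only [hA, of_apply, Sum.elim_inl, if_neg (not_le.2 hxp), dif_pos ha]
            rfl
          · exact (Finset.sum_eq_zero fun a _ => by
              simp only [hA, of_apply, Sum.elim_inl, if_pos (not_lt.1 hxp), zero_mul]).symm
        · refine Finset.sum_congr rfl fun b _ => ?_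
          have hb : (b : ℕ) < p + q := b.isLt.trans_le hj
          simp only [hA, of_apply, Sum.elim_inr, dif_pos hb]
          rfl
      simp only [Pi.add_apply, Pi.smul_apply, smul_eq_mul, Pi.zero_apply, Ipq, mulVec_diagonal]
      split_ifs at hx' ⊢ <;> linear_combination 2 * hx'
    have h2 := congrArg (M *ᵥ ·) h1
    simp only [mulVec_add, mulVec_smul, mulVec_zero] at h2
    rw [mulVec_mulVec, mulVec_mulVec, mulVec_mulVec, mulVec_mulVec, mul_nonsing_inv M hM,
      one_mulVec, one_mulVec] at h2
    change reflection M *ᵥ u + u + (2 : ℂ) • v = 0 at h2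
    rw [← sub_eq_zero, ← h2]
    abel
  let f : LinearMap.ker A.mulVecLin →ₗ[ℂ] LinearMap.ker (lowerBlock (reflection M) hi j).mulVecLin :=
    LinearMap.codRestrict _
      (LinearMap.funLeft ℂ ℂ (Sum.inl : Fin i → Fin i ⊕ Fin j) ∘ₗ Submodule.subtype _) <| by
      rintro ⟨z, hz⟩
      refine (lowerBlock_mulVec_eq_zero hi _).2 fun x hx => ?_
      refine (congrFun (hAz z hz) x).trans ?_
      rw [Pi.sub_apply, Pi.neg_apply, Pi.smul_apply, extendZero_castLE_eq_zero hi hij _ hx,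
        extendZero_castLE_eq_zero hj le_rfl _ hx]
      simp
  have hf : Function.Injective f := by
    rw [injective_iff_map_eq_zero]
    rintro ⟨z, hz⟩ h
    have h1 : z ∘ Sum.inl = 0 := congrArg Subtype.val h
    have h2 := hAz z hz
    rw [h1, map_zero, mulVec_zero, neg_zero, zero_sub, eq_comm, neg_eq_zero, smul_eq_zero_iff_right
      two_ne_zero] at h2
    have h3 : z ∘ Sum.inr = 0 :=
      extendZero_injective (Fin.castLE_injective hj) (h2.trans (map_zero _).symm)
    ext (a | a)
    · exact congrFun h1 a
    · exact congrFun h3 a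
  have h := LinearMap.finrank_le_finrank_of_injective hf
  have h1 := finrank_ker_add_rank A
  have h2 := finrank_ker_add_rank (lowerBlock (reflection M) hi j)
  simp only [Fintype.card_sum, Fintype.card_fin] at h1 h2
  omega

theorem rank_lowerBlock_add_le {M : Matrix (Fin (p + q)) (Fin (p + q)) ℂ}
    (hM : IsUnit M.det) {i : ℕ} (hi : i ≤ p + q) :
    (lowerBlock (reflection M) hi i).rank + (p + q - i) ≤ swRank p q M i + seRank p q M i := by
  unfold swRank seRank
  set A := Matrix.of fun (x : Fin (p + q - i)) (y : Fin p) =>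
    M ⟨i + (x : ℕ), by have := x.isLt; omega⟩ ⟨(y : ℕ), by have := y.isLt; omega⟩ with hA
  set B := Matrix.of fun (x : Fin (p + q - i)) (y : Fin q) =>
    M ⟨i + (x : ℕ), by have := x.isLt; omega⟩ ⟨p + (y : ℕ), by have := y.isLt; omega⟩ with hB
  have injA : Function.Injective (Fin.castAdd q : Fin p → Fin (p + q)) :=
    Fin.castAdd_injective p q
  have injB : Function.Injective (Fin.natAdd p : Fin q → Fin (p + q)) :=
    Fin.natAdd_injective q p
  have row : ∀ x : Fin (p + q), i ≤ x → ∃ y : Fin (p + q - i),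
      (⟨i + (y : ℕ), by have := y.isLt; omega⟩ : Fin (p + q)) = x := fun x hx =>
    ⟨⟨x - i, by have := x.isLt; omega⟩, Fin.ext (by simp only; omega)⟩
  have hAu : ∀ u, A *ᵥ u = 0 → ∀ x : Fin (p + q), i ≤ x →
      (M *ᵥ extendZero (Fin.castAdd q) u) x = 0 := by
    intro u hu x hx
    obtain ⟨y, rfl⟩ := row x hx
    rw [← submatrix_mulVec_extendZero M
      (fun y : Fin (p + q - i) => (⟨i + (y : ℕ), by have := y.isLt; omega⟩ : Fin (p + q))) injA]
    exact congrFun hu y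
  have hBu : ∀ u, B *ᵥ u = 0 → ∀ x : Fin (p + q), i ≤ x →
      (M *ᵥ extendZero (Fin.natAdd p) u) x = 0 := by
    intro u hu x hx
    obtain ⟨y, rfl⟩ := row x hx
    rw [← submatrix_mulVec_extendZero M
      (fun y : Fin (p + q - i) => (⟨i + (y : ℕ), by have := y.isLt; omega⟩ : Fin (p + q))) injB]
    exact congrFun hu y
  have hDA : ∀ u, Ipq p q *ᵥ extendZero (Fin.castAdd q) u = extendZero (Fin.castAdd q) u := by
    intro u
    ext x
    simp only [Ipq, mulVec_diagonal]
    split_ifs with hx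
    · rw [one_mul]
    · rw [extendZero_apply' u, mul_zero]
      rintro a rfl
      exact hx a.isLt
  have hDB : ∀ u, Ipq p q *ᵥ extendZero (Fin.natAdd p) u = - extendZero (Fin.natAdd p) u := by
    intro u
    ext x
    simp only [Ipq, mulVec_diagonal, Pi.neg_apply]
    split_ifs with hx
    · rw [extendZero_apply' u, mul_zero, neg_zero]
      rintro a rfl
      simp at hx
    · rw [neg_one_mul]
  let g : (LinearMap.ker A.mulVecLin × LinearMap.ker B.mulVecLin) →ₗ[ℂ] (Fin (p + q) → ℂ) :=
    M.mulVecLin ∘ₗ LinearMap.coprod (extendZero (Fin.castAdd q) ∘ₗ Submodule.subtype _)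
      (extendZero (Fin.natAdd p) ∘ₗ Submodule.subtype _)
  have hg : ∀ w, g w = M *ᵥ extendZero (Fin.castAdd q) w.1.1
      + M *ᵥ extendZero (Fin.natAdd p) w.2.1 := by
    intro w
    rw [← mulVec_add]
    rfl
  have hgx : ∀ w (x : Fin (p + q)), i ≤ x → g w x = 0 := by
    intro w x hx
    rw [hg, Pi.add_apply, hAu _ w.1.2 x hx, hBu _ w.2.2 x hx, add_zero]
  have hext : ∀ w, extendZero (Fin.castLE hi) (g w ∘ Fin.castLE hi) = g w := by
    intro w
    ext x
    by_cases hx : (x : ℕ) < i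
    · exact extendZero_apply (Fin.castLE_injective hi) _ (⟨x, hx⟩ : Fin i)
    · rw [hgx w x (not_lt.1 hx), extendZero_castLE_eq_zero hi le_rfl _ (not_lt.1 hx)]
  let f : (LinearMap.ker A.mulVecLin × LinearMap.ker B.mulVecLin) →ₗ[ℂ]
      LinearMap.ker (lowerBlock (reflection M) hi i).mulVecLin :=
    LinearMap.codRestrict _ (LinearMap.funLeft ℂ ℂ (Fin.castLE hi) ∘ₗ g) <| by
      intro w
      refine (lowerBlock_mulVec_eq_zero hi _).2 fun x hx => ?_
      change (reflection M *ᵥ extendZero (Fin.castLE hi) (g w ∘ Fin.castLE hi)) x = 0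
      rw [hext, hg, mulVec_add, reflection_mulVec_mulVec hM, reflection_mulVec_mulVec hM, hDA, hDB,
        mulVec_neg, Pi.add_apply, Pi.neg_apply, hAu _ w.1.2 x hx, hBu _ w.2.2 x hx]
      simp
  have hf : Function.Injective f := by
    rw [injective_iff_map_eq_zero]
    rintro w h
    have h1 : g w ∘ Fin.castLE hi = 0 := congrArg Subtype.val h
    have h2 : g w = 0 := by rw [← hext, h1, map_zero]
    have h3 : extendZero (Fin.castAdd q) w.1.1 + extendZero (Fin.natAdd p) w.2.1 = 0 :=
      mulVec_injective_iff_isUnit.2 ((isUnit_iff_isUnit_det M).2 hM)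
        (by rw [mulVec_zero]; exact h2)
    refine Prod.ext (Subtype.ext (funext fun a => ?_)) (Subtype.ext (funext fun a => ?_))
    · have := congrFun h3 (Fin.castAdd q a)
      rw [Pi.add_apply, extendZero_apply injA, extendZero_apply', add_zero] at this
      · exact this
      · intro b hb
        have h4 := congrArg Fin.val hb
        have h5 := a.isLt
        simp at h4
        omega
    · have := congrFun h3 (Fin.natAdd p a)
      rw [Pi.add_apply, extendZero_apply injB, extendZero_apply', zero_add] at this
      · exact this
      · intro b hb
        have h4 := congrArg Fin.val hb
        have h5 := b.isLt
        simp at h4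
        omega
  have h := LinearMap.finrank_le_finrank_of_injective hf
  rw [Module.finrank_prod] at h
  have h1 := finrank_ker_add_rank A
  have h2 := finrank_ker_add_rank B
  have h3 := finrank_ker_add_rank (lowerBlock (reflection M) hi i)
  simp only [Fintype.card_fin] at h1 h2 h3
  omega

theorem MarsSpringer.rank_lowerBlock_le {θ c : Clan p q}
    {M : Matrix (Fin (p + q)) (Fin (p + q)) ℂ} (h : MarsSpringer θ c M) {i j : ℕ} (hij : i ≤ j)
    (hi : i ≤ p + q) (hj : j ≤ p + q) :
    (lowerBlock (reflection M) hi j).rank ≤ statMid θ i j := by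
  obtain ⟨hS, h1, h2, h3⟩ := h
  have hM := hS.isUnit_det
  rcases Nat.eq_zero_or_pos i with rfl | hpos
  · refine (rank_le_card_width _).trans ?_
    simp
  rcases hij.lt_or_eq with hlt | rfl
  · have := rank_lowerBlock_add_le_auxRank hM hij hi hj
    have := h3 i j hpos hlt hj
    omega
  · have := rank_lowerBlock_add_le hM hi
    have := h1 i hpos hi
    have := h2 i hpos hi
    have := θ.stat_sum i hi
    have := θ.statPlus_le hi
    have := θ.statMinus_le hi
    omega

/-- The indicator of the event that `m` lies under the arc starting at `a` while its mate does
not lie left of that arc. -/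
def underArc (c : Clan p q) (a m : Fin (p + q)) : ℤ :=
  if a < m ∧ m < c.mate a ∧ a < c.mate m then 1 else 0

/-- The indicator of the event that `m` and its mate both lie under the arc starting at `a`. -/
def nested (c : Clan p q) (a m : Fin (p + q)) : ℤ :=
  if a < m ∧ a < c.mate m ∧ m < c.mate a ∧ c.mate m < c.mate a then 1 else 0

theorem card_crossing (c : Clan p q) {a b : Fin (p + q)} :
    (Finset.univ.filter fun st : Fin (p + q) × Fin (p + q) =>
      c.IsMatch st.1 st.2 ∧ st.1 < a ∧ a < st.2 ∧ st.2 < b).card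
      = (Finset.univ.filter fun m => c.mate m < a ∧ a < m ∧ m < b).card := by
  have h := card_filter_isMatch c fun s t => s < a ∧ a < t ∧ t < b
  refine Eq.trans (b := (Finset.univ.filter fun s => c.IsLeft s ∧
    s < a ∧ a < c.mate s ∧ c.mate s < b).card) (by convert h) ?_
  refine Finset.card_bij (fun s _ => c.mate s) ?_ (fun _ _ _ _ h => c.mate_injective h) ?_
  · intro s hs
    simp only [Finset.mem_filter, Finset.mem_univ, true_and] at hs ⊢
    rw [c.mate_invol]
    exact hs.2
  · intro m hm
    simp only [Finset.mem_filter, Finset.mem_univ, true_and] at hm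
    refine ⟨c.mate m, Finset.mem_filter.2 ⟨Finset.mem_univ _, ?_, ?_⟩, c.mate_invol m⟩
    · unfold IsLeft
      rw [c.mate_invol]
      exact hm.1.trans hm.2.1
    · rw [c.mate_invol]
      exact hm

theorem len_eq (c : Clan p q) :
    c.len = ∑ a, ((if a < c.mate a then 1 else 0) + ∑ m, c.underArc a m) := by
  have hmatch : (Finset.univ.filter fun ij : Fin (p + q) × Fin (p + q) => c.IsMatch ij.1 ij.2)
      = (Finset.univ.filter fun a => a < c.mate a).image
        fun a => (a, c.mate a) := by
    ext ⟨a, b⟩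
    simp only [Finset.mem_filter, Finset.mem_univ, true_and, Finset.mem_image]
    constructor
    · rintro ⟨h, rfl⟩
      exact ⟨a, h, rfl⟩
    · rintro ⟨d, h, hd⟩
      obtain ⟨rfl, rfl⟩ := Prod.mk.inj hd
      exact ⟨h, rfl⟩
  unfold len
  rw [hmatch, Finset.sum_image fun _ _ _ _ h => (Prod.mk.inj h).1, Finset.sum_filter]
  refine Finset.sum_congr rfl fun a _ => ?_
  split_ifs with ha
  · have h1 : ((c.mate a : ℕ) : ℤ) - ((a : ℕ) : ℤ)
        = 1 + ((Finset.univ.filter fun m => a < m ∧ m < c.mate a).card : ℤ) := by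
      have : (Finset.univ.filter fun m => a < m ∧ m < c.mate a) = Finset.Ioo a (c.mate a) := by
        ext; simp
      rw [this, Fin.card_Ioo]
      have : (a : ℕ) < c.mate a := ha
      omega
    rw [h1, c.card_crossing, add_sub_assoc]
    congr 1
    rw [Finset.natCast_card_filter, Finset.natCast_card_filter, ← Finset.sum_sub_distrib]
    refine Finset.sum_congr rfl fun m _ => ?_
    unfold underArc
    have h2 : c.mate m = a → m = c.mate a := fun h => by rw [← h, c.mate_invol]
    rcases lt_trichotomy (c.mate m) a with h | h | h
    · have := h.not_gt
      by_cases h3 : a < m <;> by_cases h4 : m < c.mate a <;> simp [h, h3, h4, this]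
    · simp [h, ← h2 h]
    · have := h.not_gt
      by_cases h3 : a < m <;> by_cases h4 : m < c.mate a <;> simp [h, h3, h4, this]
  · symm
    rw [zero_add]
    refine Finset.sum_eq_zero fun m _ => if_neg fun h => ha (h.1.trans h.2.1)

theorem Pattern.mate_apply {r s : ℕ} {θ : Clan r s} {γ : Clan p q}
    {ι : Fin (p + q) → Fin (r + s)} (h : Pattern θ γ ι) (k : Fin (p + q)) :
    θ.mate (ι k) = ι (γ.mate k) := by
  rcases lt_trichotomy k (γ.mate k) with hk | hk | hk
  · exact (h.2.2 k _ ⟨hk, rfl⟩).2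
  · rw [← hk]
    exact (h.2.1 k hk.symm).1
  · have := (h.2.2 (γ.mate k) k ⟨hk, γ.mate_invol k⟩).2
    rw [← this, θ.mate_invol]

theorem sum_eq_sum_range_add {m n : ℕ} {ι : Fin m → Fin n} (hι : Function.Injective ι)
    (f : Fin n → ℤ) :
    ∑ x, f x = ∑ k, f (ι k) + ∑ x ∈ Finset.univ.filter (fun x => ∀ k, ι k ≠ x), f x := by
  rw [← Finset.sum_filter_not_add_sum_filter _ (fun x => ∀ k, ι k ≠ x)]
  congr 1
  rw [← Finset.sum_image (f := f) (g := ι) (s := Finset.univ) fun _ _ _ _ h => hι h]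
  refine Finset.sum_congr ?_ fun _ _ => rfl
  ext x
  simp

theorem Pattern.sub_len {r s : ℕ} {θ : Clan r s} {γ : Clan p q}
    {ι : Fin (p + q) → Fin (r + s)} (h : Pattern θ γ ι) :
    θ.len - γ.len - ∑ m ∈ Finset.univ.filter (fun x => ∀ k, ι k ≠ x), ∑ a, θ.nested a m
      = ∑ m ∈ Finset.univ.filter (fun x => ∀ k, ι k ≠ x),
          ((if m < θ.mate m then 1 else 0)
            + ∑ k, (if m < ι k ∧ ι k < θ.mate m then 1 else 0)
            + ∑ a ∈ Finset.univ.filter (fun x => ∀ k, ι k ≠ x),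
                (θ.underArc m a - θ.nested a m)) := by
  have hι := h.1.injective
  set J := Finset.univ.filter (fun x => ∀ k, ι k ≠ x) with hJ
  have hunder : ∀ k l, θ.underArc (ι k) (ι l) = γ.underArc k l := fun k l => by
    simp only [underArc, h.mate_apply, h.1.lt_iff_lt]
  have hcross : ∀ m ∈ J, ∑ k, θ.underArc (ι k) m + ∑ k, θ.underArc m (ι k)
      = ∑ k, θ.nested (ι k) m + ∑ k, (if m < ι k ∧ ι k < θ.mate m then 1 else 0) := by
    intro m hm
    have hm' : ∀ k, ι k ≠ m := (Finset.mem_filter.1 hm).2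
    have hmm : ∀ k, ι k ≠ θ.mate m := fun k hk => hm' (γ.mate k) (by
      rw [← h.mate_apply, hk, θ.mate_invol])
    have key : ∑ k, (θ.underArc (ι k) m - θ.nested (ι k) m)
        = ∑ k, (if ι (γ.mate k) < m ∧ m < ι k ∧ ι k < θ.mate m then (1 : ℤ) else 0) := by
      refine Fintype.sum_equiv (⟨γ.mate, γ.mate, γ.mate_invol, γ.mate_invol⟩ : Equiv.Perm _) _ _
        fun k => ?_
      have h1 := hmm (γ.mate k)
      simp only [Equiv.coe_fn_mk, underArc, nested, h.mate_apply, γ.mate_invol]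
      split_ifs <;> omega
    rw [Finset.sum_sub_distrib] at key
    have key2 : ∑ k, (if m < ι k ∧ ι k < θ.mate m then (1 : ℤ) else 0)
        = ∑ k, (if ι (γ.mate k) < m ∧ m < ι k ∧ ι k < θ.mate m then (1 : ℤ) else 0)
          + ∑ k, θ.underArc m (ι k) := by
      rw [← Finset.sum_add_distrib]
      refine Finset.sum_congr rfl fun k _ => ?_
      have h1 := hm' (γ.mate k)
      simp only [underArc, h.mate_apply]
      split_ifs <;> omega
    rw [key2, ← key]
    ring
  have hcross' := Finset.sum_congr (rfl : J = J) hcross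
  rw [Finset.sum_add_distrib, Finset.sum_add_distrib] at hcross'
  rw [len_eq, len_eq, sum_eq_sum_range_add hι]
  simp only [sum_eq_sum_range_add hι (θ.underArc _), sum_eq_sum_range_add hι (θ.nested · _), hunder,
    h.mate_apply, h.1.lt_iff_lt, Finset.sum_add_distrib, Finset.sum_sub_distrib, ← hJ]
  rw [Finset.sum_comm] at hcross'
  rw [Finset.sum_comm (s := J) (t := J) (f := fun m a => θ.nested a m)]
  linear_combination hcross'

theorem sum_nested (c : Clan p q) (m : Fin (p + q)) :
    ∑ a, c.nested a m = (statMid c (min m (c.mate m) : Fin (p + q))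
      ((max m (c.mate m) : Fin (p + q)) + 1) : ℤ) := by
  rw [statMid_eq, Finset.natCast_card_filter]
  refine Finset.sum_congr rfl fun a _ => ?_
  refine if_congr ?_ rfl rfl
  rw [Fin.val_fin_lt, Nat.add_one_le_iff, Fin.val_fin_lt, lt_min_iff, max_lt_iff, and_assoc]
  exact ⟨fun h => ⟨h.1.trans h.2.2.1, h⟩, fun h => h.2⟩

theorem statMid_eq_statMid_succ_right (c : Clan p q) (m : Fin (p + q)) :
    statMid c m (c.mate m) = statMid c m ((c.mate m : ℕ) + 1) := by
  rw [statMid_eq, statMid_eq]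
  congr 1
  ext a
  simp only [Finset.mem_filter, Finset.mem_univ, true_and]
  refine and_congr_right fun _ => and_congr_right fun ha => ?_
  have h : (c.mate a : ℕ) ≠ c.mate m := fun h => by
    rw [c.mate_injective (Fin.ext h)] at ha
    exact lt_irrefl _ ha
  omega

theorem statMid_succ_left (c : Clan p q) (m : Fin (p + q)) :
    statMid c ((m : ℕ) + 1) ((c.mate m : ℕ) + 1) = statMid c m ((c.mate m : ℕ) + 1) := by
  rw [statMid_eq, statMid_eq]
  congr 1
  ext a
  simp only [Finset.mem_filter, Finset.mem_univ, true_and]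
  refine and_congr_right fun _ => and_congr_left fun ha => ?_
  have h : (a : ℕ) ≠ m := fun h => by
    rw [Fin.ext h] at ha
    omega
  omega

theorem MemS.statMid_le_rank {c : Clan p q} {M : Matrix (Fin (p + q)) (Fin (p + q)) ℂ}
    (h : MemS c M) {i : ℕ} (hi : i ≤ p + q) (j : ℕ) :
    statMid c i j ≤ (lowerBlock (reflection M) hi j).rank := by
  rw [statMid_eq]
  refine card_le_rank _ _ (Fin.castLE_injective hi) _ (fun a ha => ?_) fun u hu hu' => ?_
  · exact ⟨⟨a, (Finset.mem_filter.1 ha).2.2.1⟩, rfl⟩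
  · have h0 : reflection M *ᵥ u = 0 := by
      ext x
      by_cases hx : j ≤ x
      · exact hu' ⟨x, hx⟩
      · rw [mulVec, dotProduct, Pi.zero_apply]
        refine Finset.sum_eq_zero fun a _ => ?_
        by_cases ha : a ∈ Finset.univ.filter fun a : Fin (p + q) =>
            c.IsLeft a ∧ (a : ℕ) < i ∧ j ≤ (c.mate a : ℕ)
        · rw [h.reflection_col (show (x : ℕ) < c.mate a from
            (not_le.1 hx).trans_le (Finset.mem_filter.1 ha).2.2.2), zero_mul]
        · rw [hu a ha, mul_zero]
    rw [← one_mulVec u, ← reflection_mul_self h.isUnit_det, ← mulVec_mulVec, h0, mulVec_zero]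

theorem IntervalEmbed.statMid_eq {r s : ℕ} {α γ : Clan p q} {β θ : Clan r s}
    {ι : Fin (p + q) → Fin (r + s)} (hemb : IntervalEmbed α γ β θ ι)
    {M : Matrix (Fin (r + s)) (Fin (r + s)) ℂ} (hM : MarsSpringer θ β M)
    {m : Fin (r + s)} (hm : ∀ k, ι k ≠ m) (hle : m ≤ β.mate m) :
    statMid θ m ((β.mate m : ℕ) + 1) = statMid β m ((β.mate m : ℕ) + 1) := by
  obtain ⟨hγ, hα, hagree, hlen⟩ := hemb
  set J := Finset.univ.filter (fun x => ∀ k, ι k ≠ x) with hJ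
  have hmate : ∀ x ∈ J, β.mate x = θ.mate x := fun x hx =>
    (hagree x (Finset.mem_filter.1 hx).2).1
  have hmateJ : ∀ x ∈ J, β.mate x ∈ J := fun x hx => by
    refine Finset.mem_filter.2 ⟨Finset.mem_univ _, fun k hk => ?_⟩
    refine (Finset.mem_filter.1 hx).2 (α.mate k) ?_
    rw [← hα.mate_apply, hk, β.mate_invol]
  have hsum : ∑ x ∈ J, ∑ a, β.nested a x = ∑ x ∈ J, ∑ a, θ.nested a x := by
    have h1 := hγ.sub_len
    have h2 := hα.sub_len
    have h3 : ∑ m ∈ J, ((if m < θ.mate m then 1 else 0)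
            + ∑ k, (if m < ι k ∧ ι k < θ.mate m then 1 else 0)
            + ∑ a ∈ J, (θ.underArc m a - θ.nested a m))
        = ∑ m ∈ J, ((if m < β.mate m then 1 else 0)
            + ∑ k, (if m < ι k ∧ ι k < β.mate m then 1 else 0)
            + ∑ a ∈ J, (β.underArc m a - β.nested a m)) := by
      refine Finset.sum_congr rfl fun x hx => ?_
      rw [hmate x hx]
      congr 1
      refine Finset.sum_congr rfl fun a ha => ?_
      unfold underArc nested
      rw [hmate x hx, hmate a ha]
    rw [← hJ] at h1 h2
    rw [h3, ← h2] at h1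
    linarith
  have hle' : ∀ x ∈ J, ∑ a, β.nested a x ≤ ∑ a, θ.nested a x := fun x hx => by
    rw [sum_nested, sum_nested, ← hmate x hx, Nat.cast_le]
    refine (hM.1.statMid_le_rank (Fin.is_lt _).le _).trans (hM.rank_lowerBlock_le ?_ _ (Fin.is_lt _))
    exact (Fin.le_def.1 min_le_max).trans (Nat.le_succ _)
  have hmJ : m ∈ J := Finset.mem_filter.2 ⟨Finset.mem_univ _, hm⟩
  have h := (Finset.sum_eq_sum_iff_of_le hle').1 hsum m hmJ
  rw [sum_nested, sum_nested, ← hmate m hmJ, min_eq_left hle, max_eq_right hle] at h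
  exact_mod_cast h.symm

section RankEquality

variable {θ c : Clan p q} {M : Matrix (Fin (p + q)) (Fin (p + q)) ℂ} {m : Fin (p + q)}

theorem MarsSpringer.reflection_mate_apply (hM : MarsSpringer θ c M) (hθ : θ.mate m = c.mate m)
    (hle : m ≤ c.mate m)
    (hst : statMid θ m ((c.mate m : ℕ) + 1) = statMid c m ((c.mate m : ℕ) + 1))
    {k : Fin (p + q)} (hk : k ≠ m) : reflection M (c.mate m) k = 0 := by
  have h := hM.1
  rcases hk.lt_or_gt with hk | hk
  · by_contra h0
    set D := Finset.univ.filter fun a : Fin (p + q) =>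
      c.IsLeft a ∧ (a : ℕ) < m ∧ (c.mate m : ℕ) + 1 ≤ (c.mate a : ℕ) with hD
    have hDcol : ∀ a ∈ D, ∀ x ≤ c.mate m, reflection M x a = 0 := fun a ha x hx =>
      h.reflection_col (hx.trans_lt (Fin.lt_def.2 (Finset.mem_filter.1 ha).2.2.2))
    have hkD : k ∉ D := fun hk' => h0 (hDcol k hk' _ le_rfl)
    have hcard := card_le_rank (reflection M) (Subtype.val : {x : Fin (p + q) // (c.mate m : ℕ) ≤ x} → _)
      (Fin.castLE_injective (Fin.is_lt m).le) (insert k D) ?_ ?_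
    · rw [Finset.card_insert_of_notMem hkD, hD, ← Clan.statMid_eq, ← hst] at hcard
      have h1 := hM.rank_lowerBlock_le hle (Fin.is_lt m).le (Fin.is_lt (c.mate m)).le
      have h2 := θ.statMid_eq_statMid_succ_right m
      rw [hθ] at h2
      unfold lowerBlock at h1
      omega
    · intro a ha
      refine ⟨⟨a, ?_⟩, rfl⟩
      rcases Finset.mem_insert.1 ha with rfl | ha
      · exact hk
      · exact (Finset.mem_filter.1 ha).2.2.1
    · intro u hu hu'
      have huk : u k = 0 := by
        have h1 := hu' ⟨c.mate m, le_rfl⟩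
        rw [mulVec, dotProduct, Finset.sum_eq_single k] at h1
        · exact (mul_eq_zero.1 h1).resolve_left h0
        · intro a _ hak
          by_cases ha : a ∈ D
          · rw [hDcol a ha _ le_rfl, zero_mul]
          · rw [hu a (by simp [hak, ha]), mul_zero]
        · exact fun h => absurd (Finset.mem_univ _) h
      have h1 : reflection M *ᵥ u = 0 := by
        ext x
        rcases le_total (c.mate m) x with hx | hx
        · exact hu' ⟨x, hx⟩
        · rw [mulVec, dotProduct, Pi.zero_apply]
          refine Finset.sum_eq_zero fun a _ => ?_
          by_cases ha : a ∈ D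
          · rw [hDcol a ha x hx, zero_mul]
          · by_cases hak : a = k
            · rw [hak, huk, mul_zero]
            · rw [hu a (by simp [hak, ha]), mul_zero]
      rw [← one_mulVec u, ← reflection_mul_self h.isUnit_det, ← mulVec_mulVec, h1, mulVec_zero]
  · exact h.reflection_row (by rwa [c.mate_invol])

theorem MarsSpringer.reflection_apply_left (hM : MarsSpringer θ c M) (hθ : θ.mate m = c.mate m)
    (hle : m ≤ c.mate m)
    (hst : statMid θ m ((c.mate m : ℕ) + 1) = statMid c m ((c.mate m : ℕ) + 1))
    {x : Fin (p + q)} (hx : x ≠ c.mate m) : reflection M x m = 0 := by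
  have h := hM.1
  rcases hx.lt_or_gt with hx | hx
  · exact h.reflection_col hx
  · by_contra h0
    set D := (Finset.univ.filter fun a : Fin (p + q) =>
      c.IsLeft a ∧ (a : ℕ) < m ∧ (c.mate m : ℕ) + 1 ≤ (c.mate a : ℕ)).image c.mate with hD
    have hD' : ∀ b ∈ D, c.mate b < m ∧ c.mate m < b := fun b hb => by
      obtain ⟨a, ha, rfl⟩ := Finset.mem_image.1 hb
      rw [c.mate_invol]
      exact ⟨(Finset.mem_filter.1 ha).2.2.1, (Finset.mem_filter.1 ha).2.2.2⟩
    have hDrow : ∀ b ∈ D, ∀ k, m ≤ k → reflection M b k = 0 := fun b hb k hk =>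
      h.reflection_row ((hD' b hb).1.trans_le hk)
    have hxD : x ∉ D := fun hx' => h0 (hDrow x hx' _ le_rfl)
    have hm : (m : ℕ) + 1 ≤ p + q := m.isLt
    have hcard := card_le_rank (reflection M)ᵀ (Fin.castLE hm)
      (e := (Subtype.val : {x : Fin (p + q) // (c.mate m : ℕ) + 1 ≤ x} → _))
      Subtype.val_injective (insert x D) ?_ ?_
    · rw [Finset.card_insert_of_notMem hxD, hD, Finset.card_image_of_injective _ c.mate_injective,
        ← Clan.statMid_eq, ← hst, ← transpose_submatrix, rank_transpose] at hcard
      have h1 := hM.rank_lowerBlock_le (Nat.add_le_add_right hle 1) hm (Fin.is_lt (c.mate m))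
      have h2 := θ.statMid_succ_left m
      rw [hθ] at h2
      unfold lowerBlock at h1
      omega
    · intro b hb
      refine ⟨⟨b, ?_⟩, rfl⟩
      rcases Finset.mem_insert.1 hb with rfl | hb
      · exact hx
      · exact (hD' b hb).2
    · intro u hu hu'
      have hux : u x = 0 := by
        have h1 := hu' (Fin.last m)
        rw [show Fin.castLE hm (Fin.last (m : ℕ)) = m from rfl, mulVec, dotProduct,
          Finset.sum_eq_single x] at h1
        · exact (mul_eq_zero.1 h1).resolve_left h0
        · intro b _ hbx
          by_cases hb : b ∈ D
          · rw [transpose_apply, hDrow b hb _ le_rfl, zero_mul]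
          · rw [hu b (by simp [hbx, hb]), mul_zero]
        · exact fun h => absurd (Finset.mem_univ _) h
      have h1 : (reflection M)ᵀ *ᵥ u = 0 := by
        ext k
        rcases le_total k m with hk | hk
        · exact hu' ⟨k, Nat.lt_succ_of_le hk⟩
        · rw [mulVec, dotProduct, Pi.zero_apply]
          refine Finset.sum_eq_zero fun b _ => ?_
          by_cases hb : b ∈ D
          · rw [transpose_apply, hDrow b hb k hk, zero_mul]
          · by_cases hbx : b = x
            · rw [hbx, hux, mul_zero]
            · rw [hu b (by simp [hbx, hb]), mul_zero]
      rw [← one_mulVec u, ← transpose_one, ← reflection_mul_self h.isUnit_det, transpose_mul,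
        ← mulVec_mulVec, h1, mulVec_zero]

theorem MemS.apply_plusCol (h : MemS c M) {u z : Fin (p + q) → ℂ}
    (hu : ∀ k : Fin (p + q), p ≤ (k : ℕ) → u k = 0) (hz : M *ᵥ u = z) {x : Fin (p + q)}
    (hx : c.PlusLeft x) (hzx : ∀ y, c.PlusLeft y → z y = if y = x then 1 else 0)
    (y : Fin (p + q)) : M y (c.plusCol x hx) = z y := by
  have hsingle : u = Pi.single (c.plusCol x hx) 1 := by
    ext k
    rcases lt_or_ge (k : ℕ) p with hk | hk
    · obtain ⟨y, hy, rfl⟩ := c.exists_plusCol hk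
      have h1 := congrFun hz y
      rw [hzx y hy, mulVec, dotProduct, Finset.sum_eq_single (c.plusCol y hy), h.plus_pivot hy,
        one_mul] at h1
      · rw [h1, Pi.single_apply]
        refine if_congr ⟨fun h => by subst h; rfl, fun h => ?_⟩ rfl rfl
        exact countBelow_inj hy hx (congrArg Fin.val h)
      · intro k _ hk'
        rcases lt_or_ge (k : ℕ) p with hk | hk
        · rw [h.plus_row hy hk hk', zero_mul]
        · rw [hu k hk, mul_zero]
      · exact fun h => absurd (Finset.mem_univ _) h
    · rw [hu k hk, Pi.single_eq_of_ne]
      rintro rfl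
      exact absurd (c.plusCol_lt hx) (not_lt.2 hk)
  rw [← hz, hsingle, mulVec_single_one, col_apply]

theorem MemS.apply_minusCol (h : MemS c M) {u z : Fin (p + q) → ℂ}
    (hu : ∀ k : Fin (p + q), (k : ℕ) < p → u k = 0) (hz : M *ᵥ u = z) {x : Fin (p + q)}
    (hx : c.MinusLeft x) (hzx : ∀ y, c.MinusLeft y → z y = if y = x then 1 else 0)
    (y : Fin (p + q)) : M y (c.minusCol x hx) = z y := by
  have hsingle : u = Pi.single (c.minusCol x hx) 1 := by
    ext k
    rcases lt_or_ge (k : ℕ) p with hk | hk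
    · rw [hu k hk, Pi.single_eq_of_ne]
      rintro rfl
      exact absurd (c.le_minusCol hx) (not_le.2 hk)
    · obtain ⟨y, hy, rfl⟩ := c.exists_minusCol hk
      have h1 := congrFun hz y
      rw [hzx y hy, mulVec, dotProduct, Finset.sum_eq_single (c.minusCol y hy), h.minus_pivot hy,
        one_mul] at h1
      · rw [h1, Pi.single_apply]
        refine if_congr ⟨fun h => by subst h; rfl, fun h => ?_⟩ rfl rfl
        exact countBelow_inj hy hx (Nat.add_left_cancel (congrArg Fin.val h))
      · intro k _ hk'
        rcases lt_or_ge (k : ℕ) p with hk | hk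
        · rw [hu k hk, mul_zero]
        · rw [h.minus_row hy hk hk', zero_mul]
      · exact fun h => absurd (Finset.mem_univ _) h
  rw [← hz, hsingle, mulVec_single_one, col_apply]

theorem MemS.apply_mate (h : MemS c M)
    (hrow : ∀ k, k ≠ m → reflection M (c.mate m) k = 0)
    (k : Fin (p + q)) :
    M (c.mate m) k = (if (k : ℕ) < p then 1 else -1) * (reflection M (c.mate m) m * M m k) := by
  have h1 : reflection M * M = M * Ipq p q := by
    rw [reflection, Matrix.mul_assoc, nonsing_inv_mul M h.isUnit_det, Matrix.mul_one]
  have h2 := congrFun (congrFun h1 (c.mate m)) k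
  rw [Ipq, mul_diagonal, mul_apply, Finset.sum_eq_single m] at h2
  · rw [h2]
    split_ifs <;> ring
  · intro k _ hk
    rw [hrow k hk, zero_mul]
  · exact fun h => absurd (Finset.mem_univ _) h

theorem MemS.inv_apply (h : MemS c M)
    (hcol : ∀ x, x ≠ c.mate m → reflection M x m = 0)
    (k : Fin (p + q)) :
    (if (k : ℕ) < p then 1 else -1) * M⁻¹ k m = reflection M (c.mate m) m * M⁻¹ k (c.mate m) := by
  have h1 : M⁻¹ * reflection M = Ipq p q * M⁻¹ := by
    rw [reflection, ← Matrix.mul_assoc, ← Matrix.mul_assoc, nonsing_inv_mul M h.isUnit_det,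
      Matrix.one_mul]
  have h2 := congrFun (congrFun h1 k) m
  rw [Ipq, diagonal_mul, mul_apply, Finset.sum_eq_single (c.mate m)] at h2
  · rw [← h2, mul_comm]
  · intro x _ hx
    rw [hcol x hx, mul_zero]
  · exact fun h => absurd (Finset.mem_univ _) h

theorem MemS.mulVec_inv_col (h : MemS c M) (x : Fin (p + q)) :
    M *ᵥ (M⁻¹ *ᵥ Pi.single x 1) = Pi.single x 1 := by
  rw [mulVec_mulVec, mul_nonsing_inv M h.isUnit_det, one_mulVec]

theorem MemS.eq_zero_of_isPlus (h : MemS c M)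
    (hcol : ∀ x, x ≠ c.mate m → reflection M x m = 0)
    (hrow : ∀ k, k ≠ m → reflection M (c.mate m) k = 0)
    (hm : c.IsPlus m) {i k : Fin (p + q)}
    (hik : i = m ∨ (k : ℕ) = c.wNat m) (hn : ¬(i = m ∧ (k : ℕ) = c.wNat m)) : M i k = 0 := by
  have hP : c.PlusLeft m := Or.inl hm
  have ht : reflection M m m = 1 := by
    have := h.apply_mate hrow (c.plusCol m hP)
    rwa [hm.1, h.plus_pivot hP, if_pos (c.plusCol_lt hP), one_mul, mul_one, eq_comm] at this
  by_cases hk : (k : ℕ) = c.wNat m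
  · have hi : i ≠ m := fun hi => hn ⟨hi, hk⟩
    rw [plusCol_eq hP hk, h.apply_plusCol (u := M⁻¹ *ᵥ Pi.single m 1) ?_ (h.mulVec_inv_col m) hP
      (fun y _ => Pi.single_apply ..), Pi.single_eq_of_ne hi]
    intro k hk
    have := h.inv_apply hcol k
    rw [hm.1, ht, if_neg (not_lt.2 hk)] at this
    rw [mulVec_single_one, col_apply]
    linear_combination (-1 / 2 : ℂ) * this
  · obtain rfl := hik.resolve_right hk
    rcases lt_or_ge (k : ℕ) p with hkp | hkp
    · exact h.plus_row hP hkp fun h => hk (by rw [h, wNat_plusCol])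
    · have := h.apply_mate hrow k
      rw [hm.1, ht, if_neg (not_lt.2 hkp)] at this
      linear_combination (1 / 2 : ℂ) * this

theorem MemS.eq_zero_of_isMinus (h : MemS c M)
    (hcol : ∀ x, x ≠ c.mate m → reflection M x m = 0)
    (hrow : ∀ k, k ≠ m → reflection M (c.mate m) k = 0)
    (hm : c.IsMinus m) {i k : Fin (p + q)}
    (hik : i = m ∨ (k : ℕ) = c.wNat m) (hn : ¬(i = m ∧ (k : ℕ) = c.wNat m)) : M i k = 0 := by
  have hP : c.MinusLeft m := Or.inl hm
  have ht : reflection M m m = -1 := by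
    have := h.apply_mate hrow (c.minusCol m hP)
    rw [hm.1, h.minus_pivot hP, if_neg (not_lt.2 (c.le_minusCol hP))] at this
    linear_combination this
  by_cases hk : (k : ℕ) = c.wNat m
  · have hi : i ≠ m := fun hi => hn ⟨hi, hk⟩
    rw [minusCol_eq_of_minus hm hk, h.apply_minusCol (u := M⁻¹ *ᵥ Pi.single m 1) ?_
      (h.mulVec_inv_col m) hP (fun y _ => Pi.single_apply ..), Pi.single_eq_of_ne hi]
    intro k hk
    have := h.inv_apply hcol k
    rw [hm.1, ht, if_pos hk] at this
    rw [mulVec_single_one, col_apply]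
    linear_combination (1 / 2 : ℂ) * this
  · obtain rfl := hik.resolve_right hk
    rcases lt_or_ge (k : ℕ) p with hkp | hkp
    · have := h.apply_mate hrow k
      rw [hm.1, ht, if_pos hkp] at this
      linear_combination (1 / 2 : ℂ) * this
    · exact h.minus_row hP hkp fun h => hk (by rw [h, wNat_minusCol_minus hm])

theorem MemS.eq_zero_of_isLeft (h : MemS c M)
    (hcol : ∀ x, x ≠ c.mate m → reflection M x m = 0)
    (hrow : ∀ k, k ≠ m → reflection M (c.mate m) k = 0)
    (hm : c.IsLeft m) {i k : Fin (p + q)}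
    (hik : (i = m ∨ i = c.mate m) ∨ ((k : ℕ) = c.wNat m ∨ (k : ℕ) = c.wNat (c.mate m)))
    (hn : ¬((i = m ∨ i = c.mate m) ∧ ((k : ℕ) = c.wNat m ∨ (k : ℕ) = c.wNat (c.mate m)))) :
    M i k = 0 := by
  have hP : c.PlusLeft m := Or.inr hm
  have hN : c.MinusLeft m := Or.inr hm
  have hlt : m < c.mate m := hm
  have ht : reflection M (c.mate m) m = -1 := by
    have := h.apply_mate hrow (c.plusCol m hP)
    rwa [h.plus_mate hm, if_pos (c.plusCol_lt hP), h.plus_pivot hP, one_mul, mul_one, eq_comm]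
      at this
  by_cases hk : (k : ℕ) = c.wNat m ∨ (k : ℕ) = c.wNat (c.mate m)
  · have hi : i ≠ m := fun hi => hn ⟨Or.inl hi, hk⟩
    have hi' : i ≠ c.mate m := fun hi => hn ⟨Or.inr hi, hk⟩
    rcases hk with hk | hk
    · rw [plusCol_eq hP hk, h.apply_plusCol
        (u := M⁻¹ *ᵥ Pi.single m 1 - M⁻¹ *ᵥ Pi.single (c.mate m) 1) ?_ rfl hP ?_, mulVec_sub,
        h.mulVec_inv_col, h.mulVec_inv_col, Pi.sub_apply, Pi.single_eq_of_ne hi,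
        Pi.single_eq_of_ne hi', sub_zero]
      · intro k hk
        have := h.inv_apply hcol k
        rw [ht, if_neg (not_lt.2 hk)] at this
        simp only [Pi.sub_apply, mulVec_single_one, col_apply]
        linear_combination -this
      · intro y hy
        have hy' : y ≠ c.mate m := by
          rintro rfl
          rcases hy with hy | hy
          · exact hlt.ne (by simpa [c.mate_invol] using hy.1)
          · exact hlt.not_gt (by simpa [IsLeft, c.mate_invol] using hy)
        rw [mulVec_sub, h.mulVec_inv_col, h.mulVec_inv_col, Pi.sub_apply, Pi.single_eq_of_ne hy',
          sub_zero, Pi.single_apply]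
    · rw [minusCol_eq_of_left hm hk, h.apply_minusCol
        (u := M⁻¹ *ᵥ Pi.single m 1 + M⁻¹ *ᵥ Pi.single (c.mate m) 1) ?_ rfl hN ?_, mulVec_add,
        h.mulVec_inv_col, h.mulVec_inv_col, Pi.add_apply, Pi.single_eq_of_ne hi,
        Pi.single_eq_of_ne hi', add_zero]
      · intro k hk
        have := h.inv_apply hcol k
        rw [ht, if_pos hk] at this
        simp only [Pi.add_apply, mulVec_single_one, col_apply]
        linear_combination this
      · intro y hy
        have hy' : y ≠ c.mate m := by
          rintro rfl
          rcases hy with hy | hy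
          · exact hlt.ne (by simpa [c.mate_invol] using hy.1)
          · exact hlt.not_gt (by simpa [IsLeft, c.mate_invol] using hy)
        rw [mulVec_add, h.mulVec_inv_col, h.mulVec_inv_col, Pi.add_apply, Pi.single_eq_of_ne hy',
          add_zero, Pi.single_apply]
  · have h0 : M m k = 0 := by
      rcases lt_or_ge (k : ℕ) p with hkp | hkp
      · exact h.plus_row hP hkp fun h => hk (Or.inl (by rw [h, wNat_plusCol]))
      · exact h.minus_row hN hkp fun h => hk (Or.inr (by rw [h, wNat_minusCol_left hm]))
    rcases hik.resolve_right hk with rfl | rfl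
    · exact h0
    · rw [h.apply_mate hrow, h0, mul_zero, mul_zero]

theorem MemS.eq_zero_of_isolated (h : MemS c M)
    (hcol : ∀ x, x ≠ c.mate m → reflection M x m = 0)
    (hrow : ∀ k, k ≠ m → reflection M (c.mate m) k = 0)
    (hle : m ≤ c.mate m) {i k : Fin (p + q)}
    (hik : (i = m ∨ i = c.mate m) ∨ ((k : ℕ) = c.wNat m ∨ (k : ℕ) = c.wNat (c.mate m)))
    (hn : ¬((i = m ∨ i = c.mate m) ∧ ((k : ℕ) = c.wNat m ∨ (k : ℕ) = c.wNat (c.mate m)))) :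
    M i k = 0 := by
  rcases c.isPlus_or m with hm | hm | hm | hm
  · simp only [hm.1, or_self] at hik hn
    exact h.eq_zero_of_isPlus hcol hrow hm hik hn
  · simp only [hm.1, or_self] at hik hn
    exact h.eq_zero_of_isMinus hcol hrow hm hik hn
  · exact h.eq_zero_of_isLeft hcol hrow hm hik hn
  · exact absurd hm hle.not_gt

end RankEquality

theorem IntervalEmbed.eq_zero {r s : ℕ} {α γ : Clan p q} {β θ : Clan r s}
    {ι : Fin (p + q) → Fin (r + s)} (hemb : IntervalEmbed α γ β θ ι)
    {M : Matrix (Fin (r + s)) (Fin (r + s)) ℂ} (hM : MarsSpringer θ β M)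
    {m : Fin (r + s)} (hm : ∀ k, ι k ≠ m) (hle : m ≤ β.mate m) {i k : Fin (r + s)}
    (hik : (i = m ∨ i = β.mate m) ∨ ((k : ℕ) = β.wNat m ∨ (k : ℕ) = β.wNat (β.mate m)))
    (hn : ¬((i = m ∨ i = β.mate m) ∧ ((k : ℕ) = β.wNat m ∨ (k : ℕ) = β.wNat (β.mate m)))) :
    M i k = 0 := by
  have hθ := (hemb.2.2.1 m hm).1.symm
  have hst := hemb.statMid_eq hM hm hle
  exact hM.1.eq_zero_of_isolated (fun x hx => hM.reflection_apply_left hθ hle hst hx)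
    (fun k hk => hM.reflection_mate_apply hθ hle hst hk) hle hik hn

end Clan

/-- given an interval pattern embedding `[α,γ] ↪ [β,θ]` via `ι`, for every
`M` in the Mars–Springer variety `N_{θ,β}` and every position `j` outside the index set,
all entries of row `j` and of column `w_β(j)` of `M` vanish, other than the entries
required to be `±1` by (O.1)–(O.3). -/
theorem projection_rows_columns_vanish {p q r s : ℕ} (α γ : Clan p q) (β θ : Clan r s)
    (ι : Fin (p + q) → Fin (r + s))
    (hαγ : Clan.ble α γ) (hβθ : Clan.ble β θ)
    (hemb : Clan.IntervalEmbed α γ β θ ι)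
    (M : Matrix (Fin (r + s)) (Fin (r + s)) ℂ) (hM : Clan.MarsSpringer θ β M)
    (j : Fin (r + s)) (hj : ∀ k, ι k ≠ j) :
    ∀ i c : Fin (r + s),
      (i = j ∨ (c : ℕ) = β.wNat j) →
      ¬((i = j ∨ i = β.mate j) ∧
          ((c : ℕ) = β.wNat j ∨ (c : ℕ) = β.wNat (β.mate j))) →
      M i c = 0 := by
  intro i c hic hn
  rcases le_total j (β.mate j) with hle | hle
  · exact hemb.eq_zero hM hj hle (hic.imp Or.inl Or.inl) hn
  · have hj' : ∀ k, ι k ≠ β.mate j := fun k hk => hj (α.mate k) (by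
      rw [← hemb.2.1.mate_apply, hk, β.mate_invol])
    have hinv := β.mate_invol j
    refine hemb.eq_zero hM hj' (hinv.symm ▸ hle) ?_ ?_
    · rw [hinv]
      exact hic.imp Or.inr Or.inr
    · rw [hinv, or_comm, or_comm (a := (c : ℕ) = _)]
      exact hn
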